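/- Let F be a dominated varying distribution on the nonnegative integers satisfying condition (C), and assume in addition that F is intermediate regularly varying. Then P{W > x} ~ Σ_{i=0}^{∞} m^i·F̄(m^{i+1}x) as x → ∞, where W is the almost sure limit of W_n. -/

import Mathlib

open MeasureTheory Filter ProbabilityTheory

lemma gw_int3 {Ω : Type*} [MeasurableSpace Ω] {P : Measure Ω} {f g k : Ω → ℝ}
    (hf : Integrable f P) (hg : Integrable g P) (hk : Integrable k P) :
    Integrable (fun ω => f ω + g ω + k ω) P ∧
    ∫ ω, (f ω + g ω + k ω) ∂P = ∫ ω, f ω ∂P + ∫ ω, g ω ∂P + ∫ ω, k ω ∂P := by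
  have h1 : Integrable (fun ω => f ω + g ω) P := hf.add hg
  exact ⟨h1.add hk, by rw [integral_add h1 hk, integral_add hf hg]⟩

lemma gw_rpow_add {p : ℝ} (hp1 : 1 < p) (hp2 : p ≤ 2) {x s : ℝ} (hx : 0 ≤ x) (hs : 0 ≤ s) :
    (x + s) ^ p ≤ x ^ p + s ^ p + p * (x * s ^ (p - 1)) := by
  have hder : ∀ u : ℝ, HasDerivAt (fun u : ℝ => u ^ p + s ^ p + p * (u * s ^ (p - 1)) - (u + s) ^ p)
      (p * u ^ (p - 1) + p * s ^ (p - 1) - p * (u + s) ^ (p - 1)) u := by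
    intro u
    have h1 : HasDerivAt (fun u : ℝ => u ^ p) (p * u ^ (p - 1)) u := by
      have := Real.hasDerivAt_rpow_const (x := u) (p := p) (Or.inr hp1.le)
      simpa using this
    have h2 : HasDerivAt (fun u : ℝ => (u + s) ^ p) (p * (u + s) ^ (p - 1)) u := by
      have := (Real.hasDerivAt_rpow_const (x := u + s) (p := p) (Or.inr hp1.le)).comp_add_const u s
      simpa using this
    have h3 : HasDerivAt (fun u : ℝ => p * (u * s ^ (p - 1))) (p * s ^ (p - 1)) u := by
      have := ((hasDerivAt_id u).mul_const (s ^ (p - 1))).const_mul p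
      simpa using this
    have := ((h1.add_const (s ^ p)).add h3).sub h2
    exact this
  have hmono : MonotoneOn (fun u : ℝ => u ^ p + s ^ p + p * (u * s ^ (p - 1)) - (u + s) ^ p)
      (Set.Ici 0) := by
    apply monotoneOn_of_deriv_nonneg (convex_Ici 0)
    · exact fun u _ => (hder u).continuousAt.continuousWithinAt
    · exact fun u _ => (hder u).differentiableAt.differentiableWithinAt
    · intro u hu
      rw [interior_Ici] at hu
      rw [(hder u).deriv]
      have := Real.rpow_add_le_add_rpow (le_of_lt hu) hs (p := p - 1) (by linarith) (by linarith)
      nlinarith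
  have := hmono (Set.mem_Ici.2 le_rfl) (Set.mem_Ici.2 hx) hx
  simp only [Real.zero_rpow (by linarith : p ≠ 0)] at this
  simp at this
  linarith

lemma gw_exp1 {p : ℝ} (hp1 : 1 < p) (hp2 : p ≤ 2) {z : ℝ} (hz : 0 ≤ z) :
    Real.exp z ≤ 1 + z + z ^ p * Real.exp z := by
  rcases le_total z 1 with h | h
  · have h1 := Real.abs_exp_sub_one_sub_id_le (x := z) (by rwa [abs_of_nonneg hz])
    have h2 := (abs_le.1 h1).2
    have h3 : z ^ 2 ≤ z ^ p := by
      rw [← Real.rpow_two]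
      exact Real.rpow_le_rpow_of_exponent_ge' hz h (by linarith) hp2
    have h4 : 1 ≤ Real.exp z := Real.one_le_exp hz
    have h5 : 0 ≤ z ^ p := by positivity
    nlinarith
  · have h1 : 1 ≤ z ^ p := Real.one_le_rpow h (by linarith)
    have := Real.exp_pos z
    nlinarith

lemma gw_exp2 {p : ℝ} (hp1 : 1 < p) (hp2 : p ≤ 2) {z : ℝ} (hz : 0 ≤ z) :
    Real.exp (-z) ≤ 1 - z + z ^ p := by
  rcases le_total z 1 with h | h
  · have h1 := Real.abs_exp_sub_one_sub_id_le (x := -z) (by rwa [abs_neg, abs_of_nonneg hz])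
    have h2 := (abs_le.1 h1).2
    have h3 : z ^ 2 ≤ z ^ p := by
      rw [← Real.rpow_two]
      exact Real.rpow_le_rpow_of_exponent_ge' hz h (by linarith) hp2
    nlinarith
  · have h1 : z ≤ z ^ p := Real.self_le_rpow_of_one_le h hp1.le
    have := Real.exp_le_one_iff.2 (by linarith : -z ≤ 0)
    linarith

/-- i.i.d. nonnegative variables with mean one and p-th moment at most M. -/
structure GwIid {Ω : Type*} [MeasurableSpace Ω] (P : Measure Ω) (X : ℕ → Ω → ℝ) (p M : ℝ) :
    Prop where
  prob : IsProbabilityMeasure P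
  meas : ∀ i, Measurable (X i)
  nonneg : ∀ i ω, 0 ≤ X i ω
  indep : iIndepFun X P
  ident : ∀ i, IdentDistrib (X i) (X 0) P P
  int1 : Integrable (X 0) P
  mean : ∫ ω, X 0 ω ∂P = 1
  intp : Integrable (fun ω => X 0 ω ^ p) P
  mom : ∫ ω, X 0 ω ^ p ∂P ≤ M
  hp1 : 1 < p
  hp2 : p ≤ 2

namespace GwIid
variable {Ω : Type*} [MeasurableSpace Ω] {P : Measure Ω} {X : ℕ → Ω → ℝ} {p M : ℝ}

lemma integrable_i (h : GwIid P X p M) (i : ℕ) : Integrable (X i) P :=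
  (h.ident i).integrable_iff.2 h.int1

lemma mean_i (h : GwIid P X p M) (i : ℕ) : ∫ ω, X i ω ∂P = 1 := by
  rw [(h.ident i).integral_eq, h.mean]

lemma mean_sum (h : GwIid P X p M) (s : Finset ℕ) : ∫ ω, ∑ i ∈ s, X i ω ∂P = s.card := by
  rw [integral_finsetSum _ (fun i _ => h.integrable_i i)]
  simp [h.mean_i]

lemma tail_i (h : GwIid P X p M) (i : ℕ) (t : ℝ) :
    P.real {ω | t < X i ω} = P.real {ω | t < X 0 ω} := by
  have := (h.ident i).measure_mem_eq (s := Set.Ioi t) measurableSet_Ioi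
  simp only [Measure.real]
  exact congrArg _ this

lemma trunc (h : GwIid P X p M) {T l y : ℝ} (hl : 0 ≤ l) (hT : 0 ≤ T) (N : ℕ) :
    P.real {ω | y < ∑ i ∈ Finset.range N, min (X i ω) T} ≤
      Real.exp (-(l * y) + N * (l + l ^ p * M * Real.exp (l * T))) := by
  have := h.prob
  have hp1 := h.hp1
  have hp2 := h.hp2
  set Y : ℕ → Ω → ℝ := fun i ω => min (X i ω) T with hY
  have hYm : ∀ i, Measurable (Y i) := fun i => (h.meas i).min measurable_const
  have hYind : iIndepFun Y P := h.indep.comp (fun _ x => min x T)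
    (fun _ => measurable_id.min measurable_const)
  have hYint : ∀ i, Integrable (fun ω => Real.exp (l * Y i ω)) P := by
    intro i
    refine Integrable.of_bound (C := Real.exp (l * T)) ?_ ?_
    · exact ((hYm i).const_mul l).exp.aestronglyMeasurable
    · refine Eventually.of_forall fun ω => ?_
      rw [Real.norm_eq_abs, abs_of_pos (Real.exp_pos _)]
      exact Real.exp_le_exp.2 (mul_le_mul_of_nonneg_left (min_le_right _ _) hl)
  have hYid : ∀ i, IdentDistrib (Y i) (Y 0) P P := fun i =>
    (h.ident i).comp (measurable_id.min measurable_const : Measurable fun x : ℝ => min x T)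
  have hmgf0 : mgf (Y 0) P l ≤ Real.exp (l + l ^ p * M * Real.exp (l * T)) := by
    have hpt : ∀ ω, Real.exp (l * Y 0 ω) ≤ 1 + l * X 0 ω + (l ^ p * Real.exp (l * T)) * X 0 ω ^ p := by
      intro ω
      have hx := h.nonneg 0 ω
      have hy0 : 0 ≤ Y 0 ω := le_min hx hT
      have h1 := gw_exp1 hp1 hp2 (mul_nonneg hl hy0)
      have h2 : l * Y 0 ω ≤ l * X 0 ω := mul_le_mul_of_nonneg_left (min_le_left _ _) hl
      have h3 : (l * Y 0 ω) ^ p ≤ l ^ p * X 0 ω ^ p := by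
        rw [← Real.mul_rpow hl hx]
        exact Real.rpow_le_rpow (mul_nonneg hl hy0) h2 (by linarith)
      have h4 : Real.exp (l * Y 0 ω) ≤ Real.exp (l * T) :=
        Real.exp_le_exp.2 (mul_le_mul_of_nonneg_left (min_le_right _ _) hl)
      have h5 : (l * Y 0 ω) ^ p * Real.exp (l * Y 0 ω) ≤ l ^ p * X 0 ω ^ p * Real.exp (l * T) := by
        gcongr
      nlinarith
    have hi : Integrable (fun ω => 1 + l * X 0 ω + (l ^ p * Real.exp (l * T)) * X 0 ω ^ p) P :=
      ((integrable_const 1).add (h.int1.const_mul l)).add (h.intp.const_mul _)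
    have h6 : mgf (Y 0) P l ≤ 1 + l + (l ^ p * Real.exp (l * T)) * ∫ ω, X 0 ω ^ p ∂P := by
      calc mgf (Y 0) P l ≤ ∫ ω, (1 + l * X 0 ω + (l ^ p * Real.exp (l * T)) * X 0 ω ^ p) ∂P :=
            integral_mono (hYint 0) hi hpt
        _ = _ := by
          rw [(gw_int3 (integrable_const 1) (h.int1.const_mul l) (h.intp.const_mul _)).2,
            integral_const_mul, integral_const_mul, h.mean]
          simp
    have h7 : (l ^ p * Real.exp (l * T)) * ∫ ω, X 0 ω ^ p ∂P ≤ (l ^ p * Real.exp (l * T)) * M :=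
      mul_le_mul_of_nonneg_left h.mom (by positivity)
    have h8 := Real.add_one_le_exp (l + l ^ p * M * Real.exp (l * T))
    nlinarith
  have hmgf : mgf (∑ i ∈ Finset.range N, Y i) P l ≤
      Real.exp (N * (l + l ^ p * M * Real.exp (l * T))) := by
    rw [hYind.mgf_sum hYm, Real.exp_nat_mul]
    calc ∏ i ∈ Finset.range N, mgf (Y i) P l
        ≤ ∏ i ∈ Finset.range N, Real.exp (l + l ^ p * M * Real.exp (l * T)) := by
          refine Finset.prod_le_prod (fun i _ => mgf_nonneg) fun i _ => ?_
          rw [mgf_congr_identDistrib (hYid i)]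
          exact hmgf0
      _ = _ := by simp
  have hch := measure_ge_le_exp_mul_mgf (μ := P) (X := ∑ i ∈ Finset.range N, Y i) y hl
    (hYind.integrable_exp_mul_sum hYm (fun i _ => hYint i))
  calc P.real {ω | y < ∑ i ∈ Finset.range N, min (X i ω) T}
      ≤ P.real {ω | y ≤ (∑ i ∈ Finset.range N, Y i) ω} := by
        refine measureReal_mono fun ω hω => ?_
        simp only [Set.mem_ofPred_eq, Finset.sum_apply] at hω ⊢
        exact hω.le
    _ ≤ _ := hch
    _ ≤ Real.exp (-l * y) * Real.exp (N * (l + l ^ p * M * Real.exp (l * T))) := by gcongr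
    _ = _ := by rw [← Real.exp_add]; congr 1; ring

lemma lower (h : GwIid P X p M) {l a : ℝ} (hl : 0 ≤ l) (N : ℕ) :
    P.real {ω | ∑ i ∈ Finset.range N, X i ω ≤ a} ≤
      Real.exp (l * a + N * (-l + l ^ p * M)) := by
  have := h.prob
  have hp1 := h.hp1
  have hp2 := h.hp2
  have hint : ∀ i, Integrable (fun ω => Real.exp (-l * X i ω)) P := by
    intro i
    refine Integrable.of_bound (C := 1) ?_ ?_
    · exact ((h.meas i).const_mul (-l)).exp.aestronglyMeasurable
    · refine Eventually.of_forall fun ω => ?_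
      rw [Real.norm_eq_abs, abs_of_pos (Real.exp_pos _), Real.exp_le_one_iff]
      nlinarith [h.nonneg i ω]
  have hmgf0 : mgf (X 0) P (-l) ≤ Real.exp (-l + l ^ p * M) := by
    have hpt : ∀ ω, Real.exp (-l * X 0 ω) ≤ 1 - l * X 0 ω + l ^ p * X 0 ω ^ p := by
      intro ω
      have hx := h.nonneg 0 ω
      have h1 := gw_exp2 hp1 hp2 (mul_nonneg hl hx)
      rw [Real.mul_rpow hl hx] at h1
      rwa [neg_mul]
    have hi : Integrable (fun ω => 1 - l * X 0 ω + l ^ p * X 0 ω ^ p) P :=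
      ((integrable_const 1).sub (h.int1.const_mul l)).add (h.intp.const_mul _)
    have h6 : mgf (X 0) P (-l) ≤ 1 - l + l ^ p * ∫ ω, X 0 ω ^ p ∂P := by
      calc mgf (X 0) P (-l) ≤ ∫ ω, (1 - l * X 0 ω + l ^ p * X 0 ω ^ p) ∂P :=
            integral_mono (hint 0) hi hpt
        _ = _ := by
          simp only [sub_eq_add_neg, ← neg_mul]
          rw [(gw_int3 (integrable_const 1) (h.int1.const_mul (-l)) (h.intp.const_mul _)).2]
          rw [integral_const_mul, integral_const_mul, h.mean]
          simp
    have h7 : l ^ p * ∫ ω, X 0 ω ^ p ∂P ≤ l ^ p * M :=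
      mul_le_mul_of_nonneg_left h.mom (by positivity)
    have h8 := Real.add_one_le_exp (-l + l ^ p * M)
    linarith
  have hmgf : mgf (∑ i ∈ Finset.range N, X i) P (-l) ≤ Real.exp (N * (-l + l ^ p * M)) := by
    rw [h.indep.mgf_sum h.meas, Real.exp_nat_mul]
    calc ∏ i ∈ Finset.range N, mgf (X i) P (-l)
        ≤ ∏ i ∈ Finset.range N, Real.exp (-l + l ^ p * M) := by
          refine Finset.prod_le_prod (fun i _ => mgf_nonneg) fun i _ => ?_
          rw [mgf_congr_identDistrib (h.ident i)]
          exact hmgf0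
      _ = _ := by simp
  have hch := measure_le_le_exp_mul_mgf (μ := P) (X := ∑ i ∈ Finset.range N, X i) a
    (neg_nonpos.2 hl) (h.indep.integrable_exp_mul_sum h.meas (fun i _ => hint i))
  calc P.real {ω | ∑ i ∈ Finset.range N, X i ω ≤ a}
      = P.real {ω | (∑ i ∈ Finset.range N, X i) ω ≤ a} := by simp
    _ ≤ _ := hch
    _ ≤ Real.exp (- -l * a) * Real.exp (N * (-l + l ^ p * M)) := by gcongr
    _ = _ := by rw [← Real.exp_add]; congr 1; ring

/-- upper bound for the tail of a sum -/
lemma upper (h : GwIid P X p M) {T y e : ℝ} (hy : 0 < y) (he : 0 < e) (N : ℕ) :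
    P.real {ω | y < ∑ i ∈ Finset.range N, X i ω} ≤
      N * P.real {ω | (1 - e) * y < X 0 ω}
      + N * (P.real {ω | T < X 0 ω} * min 1 (N / (e * y)))
      + P.real {ω | y < ∑ i ∈ Finset.range N, min (X i ω) T} := by
  have := h.prob
  have hsub : {ω | y < ∑ i ∈ Finset.range N, X i ω} ⊆
      ((⋃ j ∈ Finset.range N, {ω | (1 - e) * y < X j ω}) ∪
      (⋃ j ∈ Finset.range N, ({ω | T < X j ω} ∩
        {ω | e * y < (∑ i ∈ (Finset.range N).erase j, X i) ω}))) ∪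
      {ω | y < ∑ i ∈ Finset.range N, min (X i ω) T} := by
    intro ω hω
    simp only [Set.mem_ofPred_eq] at hω
    by_cases hall : ∀ j ∈ Finset.range N, X j ω ≤ T
    · right
      simp only [Set.mem_ofPred_eq]
      rwa [Finset.sum_congr rfl (fun j hj => min_eq_left (hall j hj))]
    · push Not at hall
      obtain ⟨j, hj, hjT⟩ := hall
      left
      by_cases hbig : (1 - e) * y < X j ω
      · left
        exact Set.mem_biUnion hj hbig
      · right
        refine Set.mem_biUnion hj ⟨hjT, ?_⟩
        simp only [Set.mem_ofPred_eq, Finset.sum_apply]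
        have := Finset.add_sum_erase (Finset.range N) (fun i => X i ω) hj
        push Not at hbig
        nlinarith
  have hone : ∀ j ∈ Finset.range N, P.real ({ω | T < X j ω} ∩
        {ω | e * y < (∑ i ∈ (Finset.range N).erase j, X i) ω}) ≤
        P.real {ω | T < X 0 ω} * min 1 (N / (e * y)) := by
    intro j hj
    have hind : IndepFun (X j) (∑ i ∈ (Finset.range N).erase j, X i) P :=
      (h.indep.indepFun_finsetSum_of_notMem h.meas (Finset.notMem_erase j _)).symm
    have := hind.measure_inter_preimage_eq_mul (Set.Ioi T) (Set.Ioi (e * y))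
      measurableSet_Ioi measurableSet_Ioi
    have h2 : P.real ({ω | T < X j ω} ∩ {ω | e * y < (∑ i ∈ (Finset.range N).erase j, X i) ω}) =
        P.real {ω | T < X j ω} * P.real {ω | e * y < (∑ i ∈ (Finset.range N).erase j, X i) ω} := by
      simp only [Measure.real]
      rw [← ENNReal.toReal_mul]
      exact congrArg _ this
    rw [h2, h.tail_i]
    refine mul_le_mul_of_nonneg_left (le_min measureReal_le_one ?_) measureReal_nonneg
    rw [le_div_iff₀ (by positivity), mul_comm]
    have hS0 : 0 ≤ᵐ[P] (∑ i ∈ (Finset.range N).erase j, X i) := by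
      refine Eventually.of_forall fun ω => ?_
      simp only [Pi.zero_apply, Finset.sum_apply]
      exact Finset.sum_nonneg fun i _ => h.nonneg i ω
    have hmar := mul_meas_ge_le_integral_of_nonneg hS0
      (integrable_finsetSum' _ (fun i _ => h.integrable_i i)) (e * y)
    have hE : ∫ ω, (∑ i ∈ (Finset.range N).erase j, X i) ω ∂P ≤ N := by
      simp only [Finset.sum_apply]
      rw [h.mean_sum]
      exact_mod_cast (Finset.card_le_card (Finset.erase_subset j _)).trans_eq (Finset.card_range N)
    refine le_trans (mul_le_mul_of_nonneg_left ?_ (by positivity)) (hmar.trans hE)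
    exact measureReal_mono (Set.ofPred_subset_ofPred.2 fun ω hω => le_of_lt hω)
  calc _ ≤ _ := measureReal_mono hsub
    _ ≤ _ := measureReal_union_le _ _
    _ ≤ _ := by
      gcongr
      refine (measureReal_union_le _ _).trans ?_
      gcongr
      · refine (measureReal_biUnion_finset_le _ _).trans ?_
        simp [h.tail_i]
      · refine (measureReal_biUnion_finset_le _ _).trans ?_
        refine (Finset.sum_le_sum hone).trans ?_
        simp

lemma lower_jump (h : GwIid P X p M) (y : ℝ) (N : ℕ) :
    N * P.real {ω | y < X 0 ω} - (N * P.real {ω | y < X 0 ω}) ^ 2 ≤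
    P.real {ω | y < ∑ i ∈ Finset.range N, X i ω} := by
  have := h.prob
  induction N with
  | zero => simp
  | succ N ih =>
    set g := P.real {ω | y < X 0 ω} with hg
    set q := P.real {ω | y < ∑ i ∈ Finset.range N, X i ω} with hq
    have hind : IndepFun (X N) (∑ i ∈ Finset.range N, X i) P :=
      (h.indep.indepFun_finsetSum_of_notMem h.meas Finset.notMem_range_self).symm
    have h1 : P.real ({ω | y < X N ω} ∩ {ω | y < ∑ i ∈ Finset.range N, X i ω}) = g * q := by
      have := hind.measure_inter_preimage_eq_mul (Set.Ioi y) (Set.Ioi y)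
        measurableSet_Ioi measurableSet_Ioi
      rw [hg, ← h.tail_i N, hq]
      simp only [Measure.real]
      rw [← ENNReal.toReal_mul]
      simp only [Set.preimage, Set.mem_Ioi, Finset.sum_apply] at this
      exact congrArg _ this
    have hms : MeasurableSet {ω | y < ∑ i ∈ Finset.range N, X i ω} :=
      measurableSet_lt measurable_const (Finset.measurable_fun_sum _ fun i _ => h.meas i)
    have h2 := measureReal_union_add_inter (μ := P) (s := {ω | y < X N ω})
      (t := {ω | y < ∑ i ∈ Finset.range N, X i ω}) hms
    rw [h1, h.tail_i N] at h2
    have h3 : P.real ({ω | y < X N ω} ∪ {ω | y < ∑ i ∈ Finset.range N, X i ω}) ≤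
        P.real {ω | y < ∑ i ∈ Finset.range (N + 1), X i ω} := by
      refine measureReal_mono ?_
      rintro ω (hω | hω)
      · simp only [Set.mem_ofPred_eq, Finset.sum_range_succ] at hω ⊢
        have := Finset.sum_nonneg (s := Finset.range N) fun i _ => h.nonneg i ω
        linarith
      · simp only [Set.mem_ofPred_eq, Finset.sum_range_succ] at hω ⊢
        have := h.nonneg N ω
        linarith
    have hg0 : 0 ≤ g := measureReal_nonneg
    have hg1 : g ≤ 1 := measureReal_le_one
    push_cast
    have hN : (0 : ℝ) ≤ N := Nat.cast_nonneg N
    have h4 : (1 - g) * (N * g - (N * g) ^ 2) ≤ (1 - g) * q :=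
      mul_le_mul_of_nonneg_left ih (by linarith)
    have h5 : 0 ≤ N * g ^ 2 := by positivity
    have h6 : 0 ≤ (N : ℝ) ^ 2 * g ^ 3 := by positivity
    have h7 : 0 ≤ g ^ 2 := by positivity
    nlinarith

/-- p-th moment of a sum -/
lemma mom_sum (h : GwIid P X p M) (N : ℕ) :
    Integrable (fun ω => (∑ i ∈ Finset.range N, X i ω) ^ p) P ∧
    ∫ ω, (∑ i ∈ Finset.range N, X i ω) ^ p ∂P ≤ N * M + p * N ^ p := by
  have := h.prob
  have hp1 := h.hp1
  have hp2 := h.hp2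
  induction N with
  | zero => simp [Real.zero_rpow (by linarith : p ≠ 0)]
  | succ N ih =>
    obtain ⟨ihi, ihm⟩ := ih
    set S : Ω → ℝ := fun ω => ∑ i ∈ Finset.range N, X i ω with hS
    have hSm : Measurable S := Finset.measurable_fun_sum _ fun i _ => h.meas i
    have hS0 : ∀ ω, 0 ≤ S ω := fun ω => Finset.sum_nonneg fun i _ => h.nonneg i ω
    have hSi : Integrable S P := integrable_finsetSum _ fun i _ => h.integrable_i i
    have hind : IndepFun (X N) S P := by
      have := (h.indep.indepFun_finsetSum_of_notMem h.meas
        (Finset.notMem_range_self (n := N))).symm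
      have e : (∑ i ∈ Finset.range N, X i) = S := by ext ω; simp [hS]
      rwa [e] at this
    have hind2 : IndepFun (X N) (fun ω => S ω ^ (p - 1)) P :=
      hind.comp measurable_id (by fun_prop : Measurable fun x : ℝ => x ^ (p - 1))
    have hSd : Integrable (fun ω => S ω ^ (p - 1)) P := by
      refine Integrable.mono' ((integrable_const (1:ℝ)).add hSi)
        (hSm.pow_const _).aestronglyMeasurable (Eventually.of_forall fun ω => ?_)
      rw [Real.norm_eq_abs, abs_of_nonneg (Real.rpow_nonneg (hS0 ω) _)]
      simp only [Pi.add_apply]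
      rcases le_total (S ω) 1 with h1 | h1
      · have := Real.rpow_le_one (hS0 ω) h1 (by linarith : 0 ≤ p - 1)
        linarith [hS0 ω]
      · have := Real.rpow_le_rpow_of_exponent_le h1 (by linarith : p - 1 ≤ 1)
        rw [Real.rpow_one] at this
        linarith
    have hSd' : ∫ ω, S ω ^ (p - 1) ∂P ≤ (N : ℝ) ^ (p - 1) := by
      have hc : ConcaveOn ℝ (Set.Ici 0) fun x : ℝ => x ^ (p - 1) :=
        Real.concaveOn_rpow (by linarith) (by linarith)
      have := hc.le_map_integral (μ := P) (f := S)
        ((Real.continuous_rpow_const (by linarith)).continuousOn) isClosed_Ici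
        (Eventually.of_forall fun ω => hS0 ω) hSi hSd
      rw [hS, h.mean_sum, Finset.card_range] at this
      exact this
    have hpi : Integrable (fun ω => X N ω * S ω ^ (p - 1)) P :=
      hind2.integrable_mul (h.integrable_i N) hSd
    have hpm : ∫ ω, X N ω * S ω ^ (p - 1) ∂P ≤ (N : ℝ) ^ (p - 1) := by
      have := hind2.integral_fun_mul_eq_mul_integral (h.meas N).aestronglyMeasurable
        hSd.aestronglyMeasurable
      rw [this, h.mean_i, one_mul]
      exact hSd'
    have hidp : IdentDistrib (fun ω => X N ω ^ p) (fun ω => X 0 ω ^ p) P P :=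
      (h.ident N).comp (by fun_prop : Measurable fun x : ℝ => x ^ p)
    have hXi : Integrable (fun ω => X N ω ^ p) P := hidp.integrable_iff.2 h.intp
    have hXm : ∫ ω, X N ω ^ p ∂P ≤ M := by rw [hidp.integral_eq]; exact h.mom
    have hpt : ∀ ω, (∑ i ∈ Finset.range (N + 1), X i ω) ^ p ≤
        X N ω ^ p + S ω ^ p + p * (X N ω * S ω ^ (p - 1)) := by
      intro ω
      rw [Finset.sum_range_succ, add_comm]
      exact gw_rpow_add hp1 hp2 (h.nonneg N ω) (hS0 ω)
    have hdi : Integrable (fun ω => X N ω ^ p + S ω ^ p + p * (X N ω * S ω ^ (p - 1))) P :=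
      (hXi.add ihi).add (hpi.const_mul p)
    have hi : Integrable (fun ω => (∑ i ∈ Finset.range (N + 1), X i ω) ^ p) P := by
      refine Integrable.mono' hdi ?_ (Eventually.of_forall fun ω => ?_)
      · exact ((Finset.measurable_fun_sum _ fun i _ => h.meas i).pow_const _).aestronglyMeasurable
      · rw [Real.norm_eq_abs, abs_of_nonneg]
        · exact hpt ω
        · exact Real.rpow_nonneg (Finset.sum_nonneg fun i _ => h.nonneg i ω) _
    refine ⟨hi, ?_⟩
    have h1 : ∫ ω, (∑ i ∈ Finset.range (N + 1), X i ω) ^ p ∂P ≤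
        M + (N * M + p * N ^ p) + p * N ^ (p - 1) := by
      calc _ ≤ ∫ ω, (X N ω ^ p + S ω ^ p + p * (X N ω * S ω ^ (p - 1))) ∂P :=
            integral_mono hi hdi hpt
        _ = ∫ ω, X N ω ^ p ∂P + ∫ ω, S ω ^ p ∂P + p * ∫ ω, X N ω * S ω ^ (p - 1) ∂P := by
            rw [(gw_int3 hXi ihi (hpi.const_mul p)).2, integral_const_mul]
        _ ≤ _ := by gcongr
    have h2 : (N : ℝ) ^ p + N ^ (p - 1) ≤ ((N + 1 : ℕ) : ℝ) ^ p := by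
      have e1 : (N : ℝ) ^ p = N ^ (p - 1) * N := by
        rcases Nat.eq_zero_or_pos N with h0 | h0
        · subst h0; simp [Real.zero_rpow (by linarith : p ≠ 0)]
        · rw [← Real.rpow_add_one (by positivity)]; congr 1; ring
      have e2 : ((N + 1 : ℕ) : ℝ) ^ p = ((N + 1 : ℕ) : ℝ) ^ (p - 1) * ((N + 1 : ℕ) : ℝ) := by
        rw [← Real.rpow_add_one (by positivity)]; congr 1; ring
      have e3 : (N : ℝ) ^ (p - 1) ≤ ((N + 1 : ℕ) : ℝ) ^ (p - 1) :=
        Real.rpow_le_rpow (by positivity) (by push_cast; linarith) (by linarith)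
      rw [e1, e2]
      push_cast at e3 ⊢
      nlinarith [Nat.cast_nonneg (α := ℝ) N]
    push_cast at h2 ⊢
    nlinarith

end GwIid


/-- law of the sum of N independent copies -/
noncomputable def gwCp (q : PMF ℕ) : ℕ → PMF ℕ
  | 0 => PMF.pure 0
  | N + 1 => (gwCp q N).bind fun b => q.bind fun a => PMF.pure (b + a)

/-- law of the n-th generation -/
noncomputable def gwNu (q : PMF ℕ) : ℕ → PMF ℕ
  | 0 => PMF.pure 1
  | n + 1 => (gwNu q n).bind (gwCp q)

lemma gwCp_add (q : PMF ℕ) (a b : ℕ) :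
    gwCp q (a + b) = (gwCp q a).bind fun s => (gwCp q b).bind fun t => PMF.pure (s + t) := by
  induction b with
  | zero => simp [gwCp]
  | succ b ih =>
    rw [← add_assoc]
    simp only [gwCp, ih, PMF.bind_bind, PMF.pure_bind, add_assoc]

lemma gwCp_bind (q r : PMF ℕ) (N : ℕ) :
    (gwCp q N).bind (gwCp r) = gwCp (q.bind (gwCp r)) N := by
  induction N with
  | zero => simp [gwCp]
  | succ N ih =>
    simp only [gwCp, ← ih, PMF.bind_bind, PMF.pure_bind, gwCp_add]
    congr 1
    funext b
    rw [PMF.bind_comm]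

lemma gwCp_pure (N : ℕ) : gwCp (PMF.pure 1) N = PMF.pure N := by
  induction N with
  | zero => simp [gwCp]
  | succ N ih => simp [gwCp, ih]

lemma gwNu_add (q : PMF ℕ) (n k : ℕ) :
    gwNu q (n + k) = (gwNu q k).bind (gwCp (gwNu q n)) := by
  induction n with
  | zero =>
    have : gwCp (gwNu q 0) = PMF.pure := by funext N; exact gwCp_pure N
    rw [this, zero_add, PMF.bind_pure]
  | succ n ih =>
    have h1 : gwCp (gwNu q (n + 1)) = fun N => (gwCp (gwNu q n) N).bind (gwCp q) := by
      funext N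
      rw [gwCp_bind]
      rfl
    rw [h1, ← PMF.bind_bind, ← ih, show n + 1 + k = (n + k) + 1 by ring]
    rfl

lemma gw_law_bind {Ω : Type*} [MeasurableSpace Ω] (P : Measure Ω)
    (U : Ω → ℕ) (hU : Measurable U) (g : ℕ → Ω → ℕ) (hg : ∀ b, Measurable (g b))
    (r : PMF ℕ) (k : ℕ → PMF ℕ) (z : ℕ)
    (h : ∀ b, P ({ω | U ω = b} ∩ {ω | g b ω = z}) = r b * k b z) :
    P {ω | g (U ω) ω = z} = (r.bind k) z := by
  have hs : {ω | g (U ω) ω = z} = ⋃ b, ({ω | U ω = b} ∩ {ω | g b ω = z}) := by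
    ext ω
    simp
  rw [hs, measure_iUnion, PMF.bind_apply]
  · exact tsum_congr h
  · intro b c hbc
    refine Set.disjoint_left.2 fun ω h1 h2 => hbc ?_
    exact h1.1.symm.trans h2.1
  · exact fun b => (hU (measurableSet_singleton b)).inter (hg b (measurableSet_singleton z))

lemma gw_law_sum {Ω : Type*} [MeasurableSpace Ω] (P : Measure Ω) [IsProbabilityMeasure P]
    (X : ℕ → Ω → ℕ) (hX : ∀ i, Measurable (X i)) (hi : iIndepFun X P) (q : PMF ℕ)
    (hq : ∀ i a, P {ω | X i ω = a} = q a) (N z : ℕ) :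
    P {ω | ∑ i ∈ Finset.range N, X i ω = z} = gwCp q N z := by
  induction N generalizing z with
  | zero =>
    by_cases hz : z = 0
    · subst hz; simp [gwCp]
    · simp [gwCp, hz, Ne.symm hz]
  | succ N ih =>
    simp only [Finset.sum_range_succ, gwCp]
    have hind : IndepFun (∑ i ∈ Finset.range N, X i) (X N) P :=
      hi.indepFun_finsetSum_of_notMem hX Finset.notMem_range_self
    refine gw_law_bind P (fun ω => ∑ i ∈ Finset.range N, X i ω)
      (Finset.measurable_fun_sum _ fun i _ => hX i) (fun b ω => b + X N ω)
      (fun b => measurable_const.add (hX N)) (gwCp q N)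
      (fun b => q.bind fun a => PMF.pure (b + a)) z fun b => ?_
    have h1 := hind.measure_inter_preimage_eq_mul {b} {a | b + a = z} trivial trivial
    have e1 : (∑ i ∈ Finset.range N, X i) ⁻¹' {b} = {ω | ∑ i ∈ Finset.range N, X i ω = b} := by
      ext ω; simp
    have e2 : X N ⁻¹' {a | b + a = z} = {ω | b + X N ω = z} := rfl
    rw [e1, e2, ih] at h1
    rw [h1]
    congr 1
    have := gw_law_bind P (X N) (hX N) (fun a _ => b + a) (fun a => measurable_const) q
      (fun a => PMF.pure (b + a)) z (fun a => ?_)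
    · exact this
    · by_cases hz : z = b + a
      · subst hz
        simp [hq]
      · simp [hz, Ne.symm hz]

lemma gw_lint {Ω : Type*} [MeasurableSpace Ω] (P : Measure Ω) (U : Ω → ℕ) (hU : Measurable U)
    (r : PMF ℕ) (h : ∀ a, P {ω | U ω = a} = r a) (f : ℕ → ENNReal) :
    ∫⁻ ω, f (U ω) ∂P = ∑' a, f a * r a := by
  rw [← lintegral_map (f := f) measurable_from_top hU, lintegral_countable']
  refine tsum_congr fun a => ?_
  rw [Measure.map_apply hU (measurableSet_singleton a), ← h a]
  rfl

lemma gw_tsum_bind (r : PMF ℕ) (k : ℕ → PMF ℕ) (f : ℕ → ENNReal) :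
    ∑' a, f a * (r.bind k) a = ∑' b, (∑' a, f a * k b a) * r b := by
  simp only [PMF.bind_apply, ← ENNReal.tsum_mul_left, ← ENNReal.tsum_mul_right]
  rw [ENNReal.tsum_comm]
  refine tsum_congr fun b => tsum_congr fun a => ?_
  ring

section
variable {Ω : Type*} [MeasurableSpace Ω] {μ : Measure Ω} [IsProbabilityMeasure μ]
  {ξ : ℕ → ℕ → Ω → ℕ} {Z : ℕ → Ω → ℕ}

lemma gw_Z_meas (m' : MeasurableSpace Ω) (n : ℕ)
    (hm : ∀ k < n, ∀ i, Measurable[m'] (ξ k i))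
    (hZ0 : ∀ ω, Z 0 ω = 1)
    (hZrec : ∀ n ω, Z (n + 1) ω = ∑ i ∈ Finset.range (Z n ω), ξ n i ω) : Measurable[m'] (Z n) := by
  induction n with
  | zero =>
    have : Z 0 = fun _ => 1 := funext hZ0
    rw [this]
    exact measurable_const
  | succ n ih =>
    have ih' := ih fun k hk => hm k (hk.trans (Nat.lt_succ_self n))
    refine measurable_to_countable' fun z => ?_
    have hs : Z (n + 1) ⁻¹' {z} =
        ⋃ b, ((Z n) ⁻¹' {b} ∩ (fun ω => ∑ i ∈ Finset.range b, ξ n i ω) ⁻¹' {z}) := by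
      ext ω
      simp [hZrec]
    rw [hs]
    refine MeasurableSet.iUnion fun b => (ih' (measurableSet_singleton b)).inter ?_
    exact (Finset.measurable_fun_sum _ fun i _ => hm n (Nat.lt_succ_self n) i)
      (measurableSet_singleton z)

lemma gw_Z_law (hmeas : ∀ n i, Measurable (ξ n i))
    (hindep : iIndepFun (fun p : ℕ × ℕ => ξ p.1 p.2) μ)
    (q : PMF ℕ) (hq : ∀ n i a, μ {ω | ξ n i ω = a} = q a)
    (hZ0 : ∀ ω, Z 0 ω = 1)
    (hZrec : ∀ n ω, Z (n + 1) ω = ∑ i ∈ Finset.range (Z n ω), ξ n i ω) (n z : ℕ) :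
    μ {ω | Z n ω = z} = gwNu q n z := by
  induction n generalizing z with
  | zero =>
    by_cases hz : z = 1
    · subst hz; simp [gwNu, hZ0]
    · simp [gwNu, hz, hZ0, Ne.symm hz]
  | succ n ih =>
    simp only [hZrec, gwNu]
    refine gw_law_bind μ (Z n) (gw_Z_meas _ n (fun k _ i => hmeas k i) hZ0 hZrec)
      (fun b ω => ∑ i ∈ Finset.range b, ξ n i ω)
      (fun b => Finset.measurable_fun_sum _ fun i _ => hmeas n i) _ _ z fun b => ?_
    have hrow : iIndepFun (fun i => ξ n i) μ :=
      hindep.precomp (g := fun i => (n, i)) (fun a b h => (Prod.mk.inj h).2)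
    rw [← gw_law_sum μ (fun i => ξ n i) (hmeas n) hrow q (hq n) b z, ← ih b]
    have hI := indep_iSup_of_disjoint
      (m := fun p : ℕ × ℕ => MeasurableSpace.comap (ξ p.1 p.2) inferInstance)
      (fun p => (hmeas p.1 p.2).comap_le) hindep.iIndep
      (S := {p | p.1 < n}) (T := {p | p.1 = n})
      (Set.disjoint_left.2 fun p h1 h2 => by
        simp only [Set.mem_ofPred_eq] at h1 h2; omega)
    refine Indep_iff _ _ _ |>.1 hI _ _ ?_ ?_
    · have hZm := gw_Z_meas (ξ := ξ) (Z := Z) (⨆ p ∈ {p : ℕ × ℕ | p.1 < n},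
        MeasurableSpace.comap (ξ p.1 p.2) inferInstance) n (fun k hk i => ?_) hZ0 hZrec
      · exact hZm (measurableSet_singleton b)
      · refine Measurable.mono (comap_measurable (ξ k i)) ?_ le_rfl
        exact le_iSup₂_of_le (f := fun (p : ℕ × ℕ) (_ : p ∈ {p : ℕ × ℕ | p.1 < n}) =>
          MeasurableSpace.comap (ξ p.1 p.2) inferInstance) (k, i) hk le_rfl
    · have hSm : Measurable[⨆ p ∈ {p : ℕ × ℕ | p.1 = n},
        MeasurableSpace.comap (ξ p.1 p.2) inferInstance]
          (fun ω => ∑ i ∈ Finset.range b, ξ n i ω) := by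
        refine Finset.measurable_fun_sum _ fun i _ => ?_
        refine Measurable.mono (comap_measurable (ξ n i)) ?_ le_rfl
        exact le_iSup₂_of_le (f := fun (p : ℕ × ℕ) (_ : p ∈ {p : ℕ × ℕ | p.1 = n}) =>
          MeasurableSpace.comap (ξ p.1 p.2) inferInstance) (n, i) rfl le_rfl
      exact hSm (measurableSet_singleton z)

/-- the branching property -/
lemma gw_branch (hmeas : ∀ n i, Measurable (ξ n i))
    (hindep : iIndepFun (fun p : ℕ × ℕ => ξ p.1 p.2) μ)
    (hident : ∀ n i, Measure.map (ξ n i) μ = Measure.map (ξ 0 0) μ)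
    (hZ0 : ∀ ω, Z 0 ω = 1)
    (hZrec : ∀ n ω, Z (n + 1) ω = ∑ i ∈ Finset.range (Z n ω), ξ n i ω) (n k : ℕ)
    (f : ℕ → ENNReal) :
    ∫⁻ ω, f (Z (n + k) ω) ∂μ = ∫⁻ ω, (∫⁻ ω', f (∑ i ∈ Finset.range (Z k ω), Z n (ω' i))
      ∂(Measure.infinitePi fun _ : ℕ => μ)) ∂μ := by
  have : IsProbabilityMeasure (μ.map (ξ 0 0)) :=
    Measure.isProbabilityMeasure_map (hmeas 0 0).aemeasurable
  set q : PMF ℕ := (μ.map (ξ 0 0)).toPMF with hqd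
  have hq : ∀ n i a, μ {ω | ξ n i ω = a} = q a := by
    intro n i a
    rw [hqd, Measure.toPMF_apply, ← hident n i, Measure.map_apply (hmeas n i)
      (measurableSet_singleton a)]
    rfl
  have hZm : ∀ n, Measurable (Z n) := fun n =>
    gw_Z_meas _ n (fun k _ i => hmeas k i) hZ0 hZrec
  have hlaw := gw_Z_law hmeas hindep q hq hZ0 hZrec
  rw [gw_lint μ (Z (n + k)) (hZm _) _ (hlaw _) f, gwNu_add, gw_tsum_bind,
    ← gw_lint μ (Z k) (hZm _) _ (hlaw _)
      (fun N => ∑' a, f a * gwCp (gwNu q n) N a)]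
  refine lintegral_congr fun ω => ?_
  symm
  refine gw_lint (Measure.infinitePi fun _ : ℕ => μ)
    (fun ω' => ∑ i ∈ Finset.range (Z k ω), Z n (ω' i))
    (Finset.measurable_fun_sum _ fun i _ => (hZm n).comp (measurable_pi_apply i)) _ (fun a => ?_) f
  refine gw_law_sum (Measure.infinitePi fun _ : ℕ => μ) (fun i ω' => Z n (ω' i))
    (fun i => (hZm n).comp (measurable_pi_apply i))
    (iIndepFun_infinitePi (P := fun _ : ℕ => μ) (X := fun _ => Z n) fun _ => hZm n) (gwNu q n)
    (fun i a => ?_) (Z k ω) a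
  rw [← hlaw n a]
  have hmp : (Measure.infinitePi fun _ : ℕ => μ).map (fun ω' => ω' i) = μ :=
    Measure.infinitePi_map_eval _ i
  have h2 := Measure.map_apply (μ := Measure.infinitePi fun _ : ℕ => μ) (measurable_pi_apply i)
    (hZm n (measurableSet_singleton a))
  rw [hmp] at h2
  exact h2.symm
end


/-- the standing assumptions -/
structure GwS {Ω : Type*} [MeasurableSpace Ω] (μ : Measure Ω) (ξ : ℕ → ℕ → Ω → ℕ)
    (Z : ℕ → Ω → ℕ) (m p : ℝ) : Prop where
  prob : IsProbabilityMeasure μ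
  hmeas : ∀ n i, Measurable (ξ n i)
  hindep : iIndepFun (fun p : ℕ × ℕ => ξ p.1 p.2) μ
  hident : ∀ n i, Measure.map (ξ n i) μ = Measure.map (ξ 0 0) μ
  hint : Integrable (fun ω => (ξ 0 0 ω : ℝ)) μ
  hm : ∫ ω, (ξ 0 0 ω : ℝ) ∂μ = m
  hm1 : 1 < m
  hZ0 : ∀ ω, Z 0 ω = 1
  hZrec : ∀ n ω, Z (n + 1) ω = ∑ i ∈ Finset.range (Z n ω), ξ n i ω
  hp1 : 1 < p
  hp2 : p ≤ 2
  hintp : Integrable (fun ω => (ξ 0 0 ω : ℝ) ^ p) μ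

namespace GwS
variable {Ω : Type*} [MeasurableSpace Ω] {μ : Measure Ω} {ξ : ℕ → ℕ → Ω → ℕ}
    {Z : ℕ → Ω → ℕ} {m p : ℝ}

lemma measZ (h : GwS μ ξ Z m p) (n : ℕ) : Measurable (Z n) :=
  gw_Z_meas _ n (fun k _ i => h.hmeas k i) h.hZ0 h.hZrec

lemma Z1 (h : GwS μ ξ Z m p) (ω : Ω) : Z 1 ω = ξ 0 0 ω := by
  have := h.hZrec 0 ω
  simpa [h.hZ0] using this

lemma branch (h : GwS μ ξ Z m p) (n k : ℕ) (φ ψ : ℕ → ℝ) (hφ : ∀ a, 0 ≤ φ a)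
    (h1 : ∀ N : ℕ, Integrable (fun ω' : ℕ → Ω => φ (∑ i ∈ Finset.range N, Z n (ω' i)))
      (Measure.infinitePi fun _ : ℕ => μ))
    (h2 : ∀ N : ℕ, ∫ ω' : ℕ → Ω, φ (∑ i ∈ Finset.range N, Z n (ω' i))
      ∂(Measure.infinitePi fun _ : ℕ => μ) ≤ ψ N)
    (h3 : Integrable (fun ω => ψ (Z k ω)) μ) :
    Integrable (fun ω => φ (Z (n + k) ω)) μ ∧
    Integrable (fun ω => ∫ ω' : ℕ → Ω, φ (∑ i ∈ Finset.range (Z k ω), Z n (ω' i))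
      ∂(Measure.infinitePi fun _ : ℕ => μ)) μ ∧
    ∫ ω, φ (Z (n + k) ω) ∂μ = ∫ ω, (∫ ω' : ℕ → Ω, φ (∑ i ∈ Finset.range (Z k ω), Z n (ω' i))
      ∂(Measure.infinitePi fun _ : ℕ => μ)) ∂μ := by
  have := h.prob
  set P := Measure.infinitePi fun _ : ℕ => μ with hP
  set χ : ℕ → ℝ := fun N => ∫ ω' : ℕ → Ω, φ (∑ i ∈ Finset.range N, Z n (ω' i)) ∂P with hχ
  have hχ0 : ∀ N, 0 ≤ χ N := fun N => integral_nonneg fun ω' => hφ _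
  have hχm : Measurable fun ω => χ (Z k ω) :=
    (measurable_from_top : Measurable χ).comp (h.measZ k)
  have hχi : Integrable (fun ω => χ (Z k ω)) μ := by
    refine Integrable.mono' h3 hχm.aestronglyMeasurable (Eventually.of_forall fun ω => ?_)
    rw [Real.norm_eq_abs, abs_of_nonneg (hχ0 _)]
    exact h2 _
  have hφm : Measurable fun ω => φ (Z (n + k) ω) := measurable_from_top.comp (h.measZ _)
  have hbr := gw_branch h.hmeas h.hindep h.hident h.hZ0 h.hZrec n k
    (fun a => ENNReal.ofReal (φ a))
  have e1 : ∀ N : ℕ, ∫⁻ ω' : ℕ → Ω, ENNReal.ofReal (φ (∑ i ∈ Finset.range N, Z n (ω' i))) ∂P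
      = ENNReal.ofReal (χ N) := fun N =>
    (ofReal_integral_eq_lintegral_ofReal (h1 N) (Eventually.of_forall fun ω' => hφ _)).symm
  simp only [← hP, e1] at hbr
  have hi : Integrable (fun ω => φ (Z (n + k) ω)) μ := by
    refine ⟨hφm.aestronglyMeasurable, ?_⟩
    rw [hasFiniteIntegral_iff_ofReal (Eventually.of_forall fun ω => hφ _), hbr,
      ← hasFiniteIntegral_iff_ofReal (Eventually.of_forall fun ω => hχ0 _)]
    exact hχi.2
  refine ⟨hi, hχi, ?_⟩
  rw [integral_eq_lintegral_of_nonneg_ae (Eventually.of_forall fun ω => hφ _)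
    hφm.aestronglyMeasurable, hbr, ← integral_eq_lintegral_of_nonneg_ae
    (Eventually.of_forall fun ω => hχ0 _) hχm.aestronglyMeasurable]

lemma iid_of (h : GwS μ ξ Z m p) (n : ℕ) {M : ℝ}
    (hi : Integrable (fun ω => (Z n ω : ℝ) / m ^ n) μ)
    (hE : ∫ ω, (Z n ω : ℝ) / m ^ n ∂μ = 1)
    (hip : Integrable (fun ω => ((Z n ω : ℝ) / m ^ n) ^ p) μ)
    (hEp : ∫ ω, ((Z n ω : ℝ) / m ^ n) ^ p ∂μ ≤ M) :
    GwIid (Measure.infinitePi fun _ : ℕ => μ) (fun i ω' => (Z n (ω' i) : ℝ) / m ^ n) p M := by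
  have := h.prob
  have hm0 : 0 < m := by linarith [h.hm1]
  have hWm : Measurable fun ω => (Z n ω : ℝ) / m ^ n :=
    (measurable_from_top.comp (h.measZ n)).div_const _
  have hmp : ∀ i, (Measure.infinitePi fun _ : ℕ => μ).map (fun ω' => ω' i) = μ :=
    fun i => Measure.infinitePi_map_eval _ i
  have hmap : ∀ i, (Measure.infinitePi fun _ : ℕ => μ).map
      (fun ω' => (Z n (ω' i) : ℝ) / m ^ n) = μ.map (fun ω => (Z n ω : ℝ) / m ^ n) := by
    intro i
    conv_rhs => rw [← hmp i]
    rw [Measure.map_map hWm (measurable_pi_apply i)]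
    rfl
  have hmi : ∀ i, Measurable (fun ω' : ℕ → Ω => (Z n (ω' i) : ℝ) / m ^ n) := fun i =>
    hWm.comp (measurable_pi_apply i)
  have hid : ∀ i, IdentDistrib (fun ω' : ℕ → Ω => (Z n (ω' i) : ℝ) / m ^ n)
      (fun ω => (Z n ω : ℝ) / m ^ n) (Measure.infinitePi fun _ : ℕ => μ) μ := fun i =>
    ⟨(hmi i).aemeasurable, hWm.aemeasurable, hmap i⟩
  have hidp : IdentDistrib (fun ω' : ℕ → Ω => ((Z n (ω' 0) : ℝ) / m ^ n) ^ p)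
      (fun ω => ((Z n ω : ℝ) / m ^ n) ^ p) (Measure.infinitePi fun _ : ℕ => μ) μ :=
    (hid 0).comp (by fun_prop : Measurable fun x : ℝ => x ^ p)
  exact
  { prob := inferInstance
    meas := hmi
    nonneg := fun i ω => by positivity
    indep := iIndepFun_infinitePi (P := fun _ : ℕ => μ) (X := fun _ ω => (Z n ω : ℝ) / m ^ n)
      fun _ => hWm
    ident := fun i => (hid i).trans (hid 0).symm
    int1 := (hid 0).integrable_iff.2 hi
    mean := by rw [(hid 0).integral_eq]; exact hE
    intp := hidp.integrable_iff.2 hip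
    mom := by rw [hidp.integral_eq]; exact hEp
    hp1 := h.hp1
    hp2 := h.hp2 }

lemma moments (h : GwS μ ξ Z m p) : ∃ M : ℝ, ∀ n : ℕ,
    Integrable (fun ω => (Z n ω : ℝ) / m ^ n) μ ∧
    ∫ ω, (Z n ω : ℝ) / m ^ n ∂μ = 1 ∧
    Integrable (fun ω => ((Z n ω : ℝ) / m ^ n) ^ p) μ ∧
    ∫ ω, ((Z n ω : ℝ) / m ^ n) ^ p ∂μ ≤ M := by
  have := h.prob
  have hp1 := h.hp1
  have hm0 : 0 < m := by linarith [h.hm1]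
  set M1 := ∫ ω, (ξ 0 0 ω : ℝ) ^ p ∂μ with hM1
  have hM10 : 0 ≤ M1 := integral_nonneg fun ω => by positivity
  have hmp : m < m ^ p := by
    have := Real.rpow_lt_rpow_of_exponent_lt h.hm1 hp1
    rwa [Real.rpow_one] at this
  set M := max 1 (p * M1 / (m ^ p - m)) with hM
  have hMM : (m * M + p * M1) / m ^ p ≤ M := by
    have h1 : p * M1 / (m ^ p - m) ≤ M := le_max_right _ _
    rw [div_le_iff₀ (by linarith)] at h1
    rw [div_le_iff₀ (by positivity)]
    linarith
  refine ⟨M, fun n => ?_⟩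
  induction n with
  | zero =>
    simp only [h.hZ0]
    simp [hM]
  | succ n ih =>
    obtain ⟨i1, i2, i3, i4⟩ := ih
    have hI := h.iid_of n i1 i2 i3 i4
    have hint1 : Integrable (fun ω => (Z 1 ω : ℝ) / m) μ := by
      simp only [h.Z1]; exact h.hint.div_const m
    have key : ∀ (ω' : ℕ → Ω) (N : ℕ), ((∑ i ∈ Finset.range N, Z n (ω' i) : ℕ) : ℝ) / m ^ (n + 1)
        = (∑ i ∈ Finset.range N, (Z n (ω' i) : ℝ) / m ^ n) / m := by
      intro ω' N
      push_cast
      rw [← Finset.sum_div, div_div, pow_succ]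
    have hfst := h.branch n 1 (fun a => (a : ℝ) / m ^ (n + 1)) (fun N => (N : ℝ) / m)
      (fun a => by positivity)
      (fun N => by
        simp only [key]
        exact (integrable_finsetSum _ fun i _ => hI.integrable_i i).div_const m)
      (fun N => by
        simp only [key]
        rw [integral_div, hI.mean_sum, Finset.card_range]) hint1
    have hval : ∀ N : ℕ, ∫ ω' : ℕ → Ω, ((∑ i ∈ Finset.range N, Z n (ω' i) : ℕ) : ℝ) / m ^ (n + 1)
        ∂(Measure.infinitePi fun _ : ℕ => μ) = N / m := fun N => by
      simp only [key]
      rw [integral_div, hI.mean_sum, Finset.card_range]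
    have hintp1 : Integrable (fun ω => ((Z 1 ω : ℝ) * M + p * (Z 1 ω : ℝ) ^ p) / m ^ p) μ := by
      simp only [h.Z1]
      exact ((h.hint.mul_const M).add (h.hintp.const_mul p)).div_const _
    have key2 : ∀ (ω' : ℕ → Ω) (N : ℕ),
        (((∑ i ∈ Finset.range N, Z n (ω' i) : ℕ) : ℝ) / m ^ (n + 1)) ^ p
        = (∑ i ∈ Finset.range N, (Z n (ω' i) : ℝ) / m ^ n) ^ p / m ^ p := by
      intro ω' N
      rw [key, Real.div_rpow (Finset.sum_nonneg fun i _ => by positivity) hm0.le]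
    have hbd : ∀ N : ℕ, ∫ ω' : ℕ → Ω,
        (((∑ i ∈ Finset.range N, Z n (ω' i) : ℕ) : ℝ) / m ^ (n + 1)) ^ p
        ∂(Measure.infinitePi fun _ : ℕ => μ) ≤ ((N : ℝ) * M + p * (N : ℝ) ^ p) / m ^ p := by
      intro N
      simp only [key2]
      rw [integral_div]
      exact div_le_div_of_nonneg_right (hI.mom_sum N).2 (by positivity)
    have hsnd := h.branch n 1 (fun a => ((a : ℝ) / m ^ (n + 1)) ^ p)
      (fun N => ((N : ℝ) * M + p * (N : ℝ) ^ p) / m ^ p)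
      (fun a => by positivity)
      (fun N => by
        simp only [key2]
        exact (hI.mom_sum N).1.div_const _) hbd hintp1
    refine ⟨hfst.1, ?_, hsnd.1, ?_⟩
    · rw [hfst.2.2]
      simp only [hval, h.Z1]
      rw [integral_div, h.hm]
      exact div_self hm0.ne'
    · rw [hsnd.2.2]
      refine (integral_mono hsnd.2.1 hintp1 fun ω => hbd _).trans ?_
      simp only [h.Z1]
      rw [integral_div, integral_add (h.hint.mul_const M) (h.hintp.const_mul p),
        integral_mul_const, integral_const_mul, h.hm]
      exact hMM

lemma tail (h : GwS μ ξ Z m p) (n k : ℕ) (x : ℝ) :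
    Integrable (fun ω => (Measure.infinitePi fun _ : ℕ => μ).real
      {ω' | m ^ k * x < ∑ i ∈ Finset.range (Z k ω), (Z n (ω' i) : ℝ) / m ^ n}) μ ∧
    μ.real {ω | x < (Z (n + k) ω : ℝ) / m ^ (n + k)} =
    ∫ ω, (Measure.infinitePi fun _ : ℕ => μ).real
      {ω' | m ^ k * x < ∑ i ∈ Finset.range (Z k ω), (Z n (ω' i) : ℝ) / m ^ n} ∂μ := by
  classical
  have := h.prob
  have hm0 : 0 < m := by linarith [h.hm1]
  set P := Measure.infinitePi fun _ : ℕ => μ with hP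
  set φ : ℕ → ℝ := fun a => if x < (a : ℝ) / m ^ (n + k) then 1 else 0 with hφ
  have hφ0 : ∀ a, 0 ≤ φ a := fun a => by simp only [hφ]; split_ifs <;> norm_num
  have hms : ∀ N : ℕ, Measurable fun ω' : ℕ → Ω => ∑ i ∈ Finset.range N, Z n (ω' i) := fun N =>
    Finset.measurable_fun_sum _ fun i _ => (h.measZ n).comp (measurable_pi_apply i)
  have hval : ∀ N : ℕ, ∫ ω' : ℕ → Ω, φ (∑ i ∈ Finset.range N, Z n (ω' i)) ∂P =
      P.real {ω' | m ^ k * x < ∑ i ∈ Finset.range N, (Z n (ω' i) : ℝ) / m ^ n} := by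
    intro N
    have hset : MeasurableSet
        {ω' : ℕ → Ω | m ^ k * x < ∑ i ∈ Finset.range N, (Z n (ω' i) : ℝ) / m ^ n} := by
      refine measurableSet_lt measurable_const (Finset.measurable_fun_sum _ fun i _ => ?_)
      exact (measurable_from_top.comp ((h.measZ n).comp (measurable_pi_apply i))).div_const _
    rw [← integral_indicator_one hset]
    refine integral_congr_ae (Eventually.of_forall fun ω' => ?_)
    simp only [hφ, Set.indicator_apply, Set.mem_ofPred_eq, Pi.one_apply]
    congr 1
    push_cast
    rw [← Finset.sum_div, lt_div_iff₀ (by positivity), lt_div_iff₀ (by positivity), pow_add]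
    apply propext
    rw [show x * (m ^ n * m ^ k) = m ^ k * x * m ^ n by ring]
  have hb := h.branch n k φ (fun _ => 1) hφ0
    (fun N => by
      refine Integrable.of_bound (C := 1) ?_ (Eventually.of_forall fun ω' => ?_)
      · exact ((measurable_from_top : Measurable φ).comp (hms N)).aestronglyMeasurable
      · rw [Real.norm_eq_abs, abs_of_nonneg (hφ0 _)]
        simp only [hφ]; split_ifs <;> norm_num)
    (fun N => by rw [hval]; exact measureReal_le_one) (integrable_const _)
  simp only [← hP, hval] at hb
  refine ⟨hb.2.1, ?_⟩
  rw [← hb.2.2]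
  have hset : MeasurableSet {ω | x < (Z (n + k) ω : ℝ) / m ^ (n + k)} :=
    measurableSet_lt measurable_const
      ((measurable_from_top.comp (h.measZ (n + k))).div_const _)
  rw [← integral_indicator_one hset]
  refine integral_congr_ae (Eventually.of_forall fun ω => ?_)
  simp only [hφ, Set.indicator_apply, Set.mem_ofPred_eq, Pi.one_apply]

end GwS


lemma gw_choice {e M p B : ℝ} (he : 0 < e) (he1 : e < 1) (hM : 0 ≤ M) (hp1 : 1 < p) (hB : 0 < B) :
    ∃ κ C : ℝ, 0 < κ ∧ κ < 1 ∧ 0 < C ∧ ∀ y : ℝ, 1 ≤ y → ∃ l : ℝ, 0 ≤ l ∧ ∀ N : ℕ,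
      (N : ℝ) ≤ (1 - e) * y →
      Real.exp (-(l * y) + N * (l + l ^ p * M * Real.exp (l * (κ * y)))) ≤ C * y ^ (-B) := by
  set K := B / e with hK
  have hK0 : 0 < K := by positivity
  set a := (p - 1) / (2 * p) with ha
  have ha0 : 0 < a := by apply div_pos <;> linarith
  have hκ0 : 0 < min ((p - 1) / (2 * K)) (1 / 2) := by
    refine lt_min (div_pos (by linarith) (by positivity)) (by norm_num)
  refine ⟨min ((p - 1) / (2 * K)) (1 / 2), Real.exp (M * (K / a) ^ p), hκ0, ?_, Real.exp_pos _, ?_⟩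
  · exact lt_of_le_of_lt (min_le_right _ _) (by norm_num)
  intro y hy
  have hy0 : 0 < y := by linarith
  have hlog : 0 ≤ Real.log y := Real.log_nonneg hy
  set κ := min ((p - 1) / (2 * K)) (1 / 2) with hκ
  refine ⟨K * Real.log y / y, by positivity, fun N hN => ?_⟩
  set l := K * Real.log y / y with hl
  have hl0 : 0 ≤ l := by positivity
  have hly : l * y = K * Real.log y := by rw [hl]; field_simp
  have h1 : Real.exp (l * (κ * y)) ≤ y ^ ((p - 1) / 2) := by
    rw [Real.rpow_def_of_pos hy0]
    apply Real.exp_le_exp.2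
    have h2 : κ * K ≤ (p - 1) / 2 := by
      have : κ ≤ (p - 1) / (2 * K) := min_le_left _ _
      rw [le_div_iff₀ (by positivity)] at this
      linarith
    calc l * (κ * y) = (l * y) * κ := by ring
      _ = Real.log y * (κ * K) := by rw [hly]; ring
      _ ≤ _ := mul_le_mul_of_nonneg_left h2 hlog
  have h3 : y * (l ^ p * M * Real.exp (l * (κ * y))) ≤ M * (K / a) ^ p := by
    have e1 : l ^ p = (K * Real.log y) ^ p / y ^ p := by
      rw [hl, Real.div_rpow (by positivity) hy0.le]
    have e2 : Real.log y ≤ y ^ a / a := Real.log_le_rpow_div hy0.le ha0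
    have e3 : (K * Real.log y) ^ p ≤ (K / a) ^ p * y ^ ((p - 1) / 2) := by
      have : K * Real.log y ≤ (K / a) * y ^ a := by
        calc K * Real.log y ≤ K * (y ^ a / a) := by gcongr
          _ = _ := by ring
      calc (K * Real.log y) ^ p ≤ ((K / a) * y ^ a) ^ p :=
            Real.rpow_le_rpow (by positivity) this (by linarith)
        _ = _ := by
          rw [Real.mul_rpow (by positivity) (by positivity), ← Real.rpow_mul hy0.le]
          congr 2
          rw [ha]; field_simp
    have e4 : y ^ p = y * (y ^ ((p - 1) / 2) * y ^ ((p - 1) / 2)) := by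
      rw [← Real.rpow_add hy0]
      conv_rhs => rw [← Real.rpow_one y, ← Real.rpow_mul hy0.le, ← Real.rpow_add hy0]
      congr 1; ring
    have hY : 0 < y ^ ((p - 1) / 2) := by positivity
    calc y * (l ^ p * M * Real.exp (l * (κ * y)))
        ≤ y * (((K / a) ^ p * y ^ ((p - 1) / 2)) / y ^ p * M * y ^ ((p - 1) / 2)) := by
          rw [e1]; gcongr
      _ = M * (K / a) ^ p := by rw [e4]; field_simp
  have h4 : (N : ℝ) * (l ^ p * M * Real.exp (l * (κ * y))) ≤
      y * (l ^ p * M * Real.exp (l * (κ * y))) := by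
    refine mul_le_mul_of_nonneg_right ?_ (by positivity)
    nlinarith
  have h5 : (N : ℝ) * l ≤ (1 - e) * (l * y) := by nlinarith
  have h6 : -(l * y) + N * (l + l ^ p * M * Real.exp (l * (κ * y))) ≤
      M * (K / a) ^ p + Real.log y * (-B) := by
    have : e * (l * y) = Real.log y * B := by rw [hly, hK]; field_simp
    nlinarith
  rw [Real.rpow_def_of_pos hy0, ← Real.exp_add]
  exact Real.exp_le_exp.2 h6

/-- assumptions on the tail function -/
structure GwF (F : ℝ → ℝ) (δ : ℝ) : Prop where
  anti : Antitone F
  pos : ∀ x, 0 < F x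
  dv : ∃ C : ℝ, ∀ x : ℝ, F (x / 2) ≤ C * F x
  hδ : 0 < δ
  hC : ∃ c : ℝ, ∀ x > (1 : ℝ), ∀ y > (1 : ℝ), F (x * y) ≤ c * F x / y ^ (1 + δ)

namespace GwF
variable {F : ℝ → ℝ} {δ : ℝ}

lemma dv1 (h : GwF F δ) : ∃ C : ℝ, 1 ≤ C ∧ ∀ (j : ℕ) (x : ℝ), F (x / 2 ^ j) ≤ C ^ j * F x := by
  obtain ⟨C, hC⟩ := h.dv
  refine ⟨max C 1, le_max_right _ _, fun j => ?_⟩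
  induction j with
  | zero => intro x; simp
  | succ j ih =>
    intro x
    have h1 := hC (x / 2 ^ j)
    have h2 : C * F (x / 2 ^ j) ≤ max C 1 * F (x / 2 ^ j) :=
      mul_le_mul_of_nonneg_right (le_max_left _ _) (h.pos _).le
    have h3 : max C 1 * F (x / 2 ^ j) ≤ max C 1 * (max C 1 ^ j * F x) :=
      mul_le_mul_of_nonneg_left (ih x) (by positivity)
    rw [pow_succ (2:ℝ), ← div_div, pow_succ (max C 1)]
    linarith [show max C 1 * (max C 1 ^ j * F x) = max C 1 ^ j * max C 1 * F x by ring]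

lemma scale (h : GwF F δ) {κ : ℝ} (hκ : 0 < κ) :
    ∃ C : ℝ, 1 ≤ C ∧ ∀ x : ℝ, 0 ≤ x → F (κ * x) ≤ C * F x := by
  obtain ⟨C, hC1, hC⟩ := h.dv1
  obtain ⟨j, hj⟩ := exists_pow_lt_of_lt_one hκ (by norm_num : (1 / 2 : ℝ) < 1)
  refine ⟨C ^ j, one_le_pow₀ hC1, fun x hx => (h.anti ?_).trans (hC j x)⟩
  have : x / 2 ^ j = (1 / 2) ^ j * x := by rw [div_pow, one_pow]; ring
  rw [this]
  exact mul_le_mul_of_nonneg_right hj.le hx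

lemma poly_lower (h : GwF F δ) : ∃ β c : ℝ, 0 < β ∧ 0 < c ∧ ∀ y : ℝ, 1 ≤ y → c * y ^ (-β) ≤ F y := by
  obtain ⟨C', hC1', hC'⟩ := h.dv1
  set C := C' + 1 with hCd
  have hC1 : 1 < C := by linarith
  have hC : ∀ (j : ℕ) (x : ℝ), F (x / 2 ^ j) ≤ C ^ j * F x := fun j x =>
    (hC' j x).trans (mul_le_mul_of_nonneg_right (pow_le_pow_left₀ (by linarith) (by linarith) j)
      (h.pos x).le)
  have hC0 : 0 < C := by linarith
  refine ⟨Real.logb 2 C, F 1 / C, Real.logb_pos (by norm_num) hC1, div_pos (h.pos 1) hC0, ?_⟩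
  intro y hy
  have hy0 : 0 < y := by linarith
  set t := Real.logb 2 y with ht
  have ht0 : 0 ≤ t := Real.logb_nonneg (by norm_num) hy
  have hyt : (2 : ℝ) ^ t = y := Real.rpow_logb (by norm_num) (by norm_num) hy0
  set j := ⌈t⌉₊ with hj
  have h1 : y / 2 ^ j ≤ 1 := by
    rw [div_le_one (by positivity), ← hyt, ← Real.rpow_natCast]
    exact Real.rpow_le_rpow_of_exponent_le (by norm_num) (Nat.le_ceil t)
  have h2 : F 1 ≤ C ^ j * F y := (h.anti h1).trans (hC j y)
  have h3 : C ^ j ≤ C * y ^ (Real.logb 2 C) := by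
    have e1 : y ^ (Real.logb 2 C) = C ^ t := by
      rw [← hyt, ← Real.rpow_mul (by norm_num), mul_comm, Real.rpow_mul (by norm_num),
        Real.rpow_logb (by norm_num) (by norm_num) hC0]
    rw [e1, ← Real.rpow_natCast, mul_comm, ← Real.rpow_add_one hC0.ne']
    exact Real.rpow_le_rpow_of_exponent_le hC1.le (Nat.ceil_lt_add_one ht0).le
  have h4 : 0 < y ^ (Real.logb 2 C) := by positivity
  rw [Real.rpow_neg hy0.le, ← div_eq_mul_inv, div_div, div_le_iff₀ (by positivity)]
  calc F 1 ≤ C ^ j * F y := h2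
    _ ≤ (C * y ^ (Real.logb 2 C)) * F y := mul_le_mul_of_nonneg_right h3 (h.pos y).le
    _ = _ := by ring

end GwF

lemma gw_moment {Ω : Type*} [MeasurableSpace Ω] {μ : Measure Ω} [IsProbabilityMeasure μ]
    {f : Ω → ℝ} (hf : Measurable f) (hf0 : ∀ ω, 0 ≤ f ω) {δ p : ℝ}
    (h : GwF (fun x => μ.real {ω | x < f ω}) δ) (hp1 : 1 < p) (hpδ : p < 1 + δ) :
    Integrable (fun ω => f ω ^ p) μ := by
  obtain ⟨c, hc⟩ := h.hC
  have hlc := lintegral_rpow_eq_lintegral_meas_lt_mul μ (f := f) (Eventually.of_forall hf0)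
    hf.aemeasurable (p := p) (by linarith)
  refine ⟨(hf.pow_const _).aestronglyMeasurable, ?_⟩
  rw [hasFiniteIntegral_iff_ofReal (Eventually.of_forall fun ω => Real.rpow_nonneg (hf0 ω) _), hlc]
  refine ENNReal.mul_lt_top ENNReal.ofReal_lt_top ?_
  rw [← Set.Ioc_union_Ioi_eq_Ioi (by norm_num : (0 : ℝ) ≤ 3)]
  refine lt_of_le_of_lt (lintegral_union_le _ _ _) (ENNReal.add_lt_top.2 ⟨?_, ?_⟩)
  · calc ∫⁻ t in Set.Ioc 0 3, μ {a | t < f a} * ENNReal.ofReal (t ^ (p - 1))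
        ≤ ∫⁻ t in Set.Ioc (0:ℝ) 3, ENNReal.ofReal (3 ^ (p - 1)) := by
          refine setLIntegral_mono measurable_const fun t ht => ?_
          calc μ {a | t < f a} * ENNReal.ofReal (t ^ (p - 1))
              ≤ 1 * ENNReal.ofReal (3 ^ (p - 1)) := by
                refine mul_le_mul' prob_le_one (ENNReal.ofReal_le_ofReal ?_)
                exact Real.rpow_le_rpow ht.1.le ht.2 (by linarith)
            _ = _ := one_mul _
      _ < ⊤ := by
        rw [setLIntegral_const]
        exact ENNReal.mul_lt_top ENNReal.ofReal_lt_top (by simp)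
  · set c' := c * μ.real {ω | 2 < f ω} / (1/2) ^ (1 + δ) with hc'
    have hint : IntegrableOn (fun t : ℝ => c' * t ^ (p - 2 - δ)) (Set.Ioi 3) :=
      (integrableOn_Ioi_rpow_of_lt (by linarith) (by norm_num)).const_mul _
    calc ∫⁻ t in Set.Ioi 3, μ {a | t < f a} * ENNReal.ofReal (t ^ (p - 1))
        ≤ ∫⁻ t in Set.Ioi (3:ℝ), ENNReal.ofReal (c' * t ^ (p - 2 - δ)) := by
          refine setLIntegral_mono (by fun_prop) fun t ht => ?_
          have ht3 : (3:ℝ) < t := ht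
          have ht0 : 0 < t := by linarith
          rw [← ofReal_measureReal, ← ENNReal.ofReal_mul measureReal_nonneg]
          refine ENNReal.ofReal_le_ofReal ?_
          have h1 := hc 2 (by norm_num) (t / 2) (by linarith)
          rw [show 2 * (t / 2) = t by ring] at h1
          have h2 : c * μ.real {ω | 2 < f ω} / (t / 2) ^ (1 + δ) = c' * t ^ (-(1 + δ)) := by
            rw [hc', Real.rpow_neg ht0.le, show t / 2 = (1/2) * t by ring,
              Real.mul_rpow (by norm_num) ht0.le]
            field_simp
          rw [h2] at h1
          calc μ.real {a | t < f a} * t ^ (p - 1)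
              ≤ (c' * t ^ (-(1 + δ))) * t ^ (p - 1) := by gcongr
            _ = c' * t ^ (p - 2 - δ) := by
              rw [mul_assoc, ← Real.rpow_add ht0]; congr 2; ring
      _ < ⊤ := by
        exact lt_of_le_of_lt (lintegral_mono fun _ => Real.ofReal_le_enorm _) hint.2


namespace GwS
variable {Ω : Type*} [MeasurableSpace Ω] {μ : Measure Ω} {ξ : ℕ → ℕ → Ω → ℕ}
    {Z : ℕ → Ω → ℕ} {m p : ℝ}

lemma tail0 (h : GwS μ ξ Z m p) (n : ℕ) (t : ℝ) :
    (Measure.infinitePi fun _ : ℕ => μ).real {ω' | t < (Z n (ω' 0) : ℝ) / m ^ n} =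
      μ.real {ω | t < (Z n ω : ℝ) / m ^ n} := by
  have := h.prob
  have hWm : Measurable fun ω => (Z n ω : ℝ) / m ^ n :=
    (measurable_from_top.comp (h.measZ n)).div_const _
  have hmp : (Measure.infinitePi fun _ : ℕ => μ).map (fun ω' => ω' 0) = μ :=
    Measure.infinitePi_map_eval _ 0
  have hs : MeasurableSet {ω | t < (Z n ω : ℝ) / m ^ n} := measurableSet_lt measurable_const hWm
  have h2 : μ.real {ω | t < (Z n ω : ℝ) / m ^ n} =
    ((Measure.infinitePi fun _ : ℕ => μ).map (fun ω' => ω' 0)).real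
      {ω | t < (Z n ω : ℝ) / m ^ n} := by rw [hmp]
  rw [h2, map_measureReal_apply (measurable_pi_apply 0) hs]
  rfl

lemma lemU (h : GwS μ ξ Z m p) : ∃ M : ℝ, 0 ≤ M ∧ ∀ e B : ℝ, 0 < e → e < 1 → 0 < B →
    ∃ κ C : ℝ, 0 < κ ∧ κ < 1 ∧ 0 < C ∧ ∀ (n k : ℕ) (x : ℝ), 1 ≤ x →
    μ.real {ω | x < (Z (n + k) ω : ℝ) / m ^ (n + k)} ≤
      μ.real {ω | (1 - e) * x < (Z k ω : ℝ) / m ^ k}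
      + m ^ k * μ.real {ω | (1 - e) * (m ^ k * x) < (Z n ω : ℝ) / m ^ n}
      + m ^ k * (M * (e * x) ^ (1 - p)) * μ.real {ω | κ * (m ^ k * x) < (Z n ω : ℝ) / m ^ n}
      + C * x ^ (-B) := by
  have := h.prob
  have hp1 := h.hp1
  have hp2 := h.hp2
  have hm1 := h.hm1
  have hm0 : 0 < m := by linarith
  obtain ⟨M, hM⟩ := h.moments
  have hM0 : 0 ≤ M := le_trans (integral_nonneg fun ω => by positivity) (hM 0).2.2.2
  refine ⟨M, hM0, fun e B he he1 hB => ?_⟩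
  obtain ⟨κ, C, hκ, hκ1, hC, hch⟩ := gw_choice he he1 hM0 hp1 hB
  refine ⟨κ, C, hκ, hκ1, hC, fun n k x hx => ?_⟩
  have hx0 : 0 < x := by linarith
  have hI := h.iid_of n (hM n).1 (hM n).2.1 (hM n).2.2.1 (hM n).2.2.2
  have ht := h.tail n k x
  rw [ht.2]
  set P := Measure.infinitePi fun _ : ℕ => μ with hP
  have hPp : IsProbabilityMeasure P := hI.prob
  have hmk : 1 ≤ m ^ k := one_le_pow₀ hm1.le
  have hmk0 : 0 < m ^ k := by positivity
  set y := m ^ k * x with hy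
  have hxy : x ≤ y := by rw [hy]; nlinarith
  have hy1 : 1 ≤ y := by linarith
  set g1 := μ.real {ω | (1 - e) * y < (Z n ω : ℝ) / m ^ n} with hg1
  set g2 := μ.real {ω | κ * y < (Z n ω : ℝ) / m ^ n} with hg2
  have hg20 : 0 ≤ g2 := measureReal_nonneg
  have hg10 : 0 ≤ g1 := measureReal_nonneg
  have hCx : 0 < C * x ^ (-B) := by positivity
  set A := {ω | (1 - e) * x < (Z k ω : ℝ) / m ^ k} with hA
  have hAm : MeasurableSet A :=
    measurableSet_lt measurable_const ((measurable_from_top.comp (h.measZ k)).div_const _)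
  have hiA : Integrable (A.indicator (1 : Ω → ℝ)) μ :=
    (integrable_indicator_iff hAm).2 (integrable_const _).integrableOn
  have hb : ∀ ω, P.real {ω' | y < ∑ i ∈ Finset.range (Z k ω), (Z n (ω' i) : ℝ) / m ^ n} ≤
      A.indicator (1 : Ω → ℝ) ω + m ^ k * g1 * ((Z k ω : ℝ) / m ^ k)
      + m ^ k * ((e * x) ^ (1 - p)) * g2 * ((Z k ω : ℝ) / m ^ k) ^ p + C * x ^ (-B) := by
    intro ω
    set w := (Z k ω : ℝ) / m ^ k with hw
    have hw0 : 0 ≤ w := by positivity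
    have hZw : (Z k ω : ℝ) = m ^ k * w := by rw [hw]; field_simp
    have hex : 0 < e * x := by positivity
    have n1 : 0 ≤ m ^ k * g1 * w := by positivity
    have n2 : 0 ≤ m ^ k * ((e * x) ^ (1 - p)) * g2 * w ^ p := by positivity
    by_cases hωA : ω ∈ A
    · rw [Set.indicator_of_mem hωA]
      have : P.real {ω' | y < ∑ i ∈ Finset.range (Z k ω), (Z n (ω' i) : ℝ) / m ^ n} ≤ 1 :=
        measureReal_le_one
      simp only [Pi.one_apply]
      linarith
    · rw [Set.indicator_of_notMem hωA]
      have hω : w ≤ (1 - e) * x := not_lt.1 hωA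
      have hN : (Z k ω : ℝ) ≤ (1 - e) * y := by
        rw [hZw, hy]; nlinarith
      obtain ⟨l, hl0, hl⟩ := hch y hy1
      have u1 := hI.upper (T := κ * y) (y := y) (e := e) (by linarith) he (Z k ω)
      have u2 := hI.trunc (T := κ * y) (y := y) hl0 (by positivity) (Z k ω)
      have u3 := hl (Z k ω) hN
      rw [h.tail0, h.tail0] at u1
      have u4 : C * y ^ (-B) ≤ C * x ^ (-B) := by
        refine mul_le_mul_of_nonneg_left ?_ hC.le
        exact Real.rpow_le_rpow_of_nonpos hx0 hxy (by linarith)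
      have u5 : (Z k ω : ℝ) * (g2 * min 1 ((Z k ω : ℝ) / (e * y))) ≤
          m ^ k * ((e * x) ^ (1 - p)) * g2 * w ^ p := by
        have e1 : (Z k ω : ℝ) / (e * y) = w / (e * x) := by
          rw [hZw, hy]; field_simp
        have e2 : min 1 (w / (e * x)) ≤ (w / (e * x)) ^ (p - 1) := by
          have hwe : 0 ≤ w / (e * x) := by positivity
          rcases le_total 1 (w / (e * x)) with hc | hc
          · exact (min_le_left _ _).trans (Real.one_le_rpow hc (by linarith))
          · rcases hwe.eq_or_lt with h0 | h0
            · rw [← h0]; rw [Real.zero_rpow (by linarith)]; simp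
            · refine (min_le_right _ _).trans ?_
              conv_lhs => rw [← Real.rpow_one (w / (e * x))]
              exact Real.rpow_le_rpow_of_exponent_ge h0 hc (by linarith)
        have e3 : w * (w / (e * x)) ^ (p - 1) = w ^ p * (e * x) ^ (1 - p) := by
          rcases hw0.eq_or_lt with h0 | h0
          · rw [← h0, Real.zero_rpow (by linarith)]; simp
          · rw [Real.div_rpow hw0 hex.le, show 1 - p = -(p - 1) by ring, Real.rpow_neg hex.le,
              div_eq_mul_inv, ← mul_assoc]
            congr 1
            conv_lhs => rw [← Real.rpow_one w, ← Real.rpow_mul hw0, ← Real.rpow_add h0]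
            congr 1; ring
        rw [e1, hZw]
        calc m ^ k * w * (g2 * min 1 (w / (e * x))) = m ^ k * g2 * (w * min 1 (w / (e * x))) := by
              ring
          _ ≤ m ^ k * g2 * (w * (w / (e * x)) ^ (p - 1)) := by gcongr
          _ = _ := by rw [e3]; ring
      have u6 : (Z k ω : ℝ) * g1 = m ^ k * g1 * w := by rw [hZw]; ring
      simp only [← hg1, ← hg2] at u1
      linarith
  have i1 := (hM k).1.const_mul (m ^ k * g1)
  have i2 := (hM k).2.2.1.const_mul (m ^ k * ((e * x) ^ (1 - p)) * g2)
  have i3 := gw_int3 hiA i1 i2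
  have i4 : Integrable (fun _ : Ω => C * x ^ (-B)) μ := integrable_const _
  refine (integral_mono ht.1 (i3.1.add i4) hb).trans ?_
  rw [integral_add' i3.1 i4, i3.2, integral_const_mul, integral_const_mul, (hM k).2.1,
    integral_indicator_one hAm]
  have : m ^ k * ((e * x) ^ (1 - p)) * g2 * ∫ ω, ((Z k ω : ℝ) / m ^ k) ^ p ∂μ ≤
      m ^ k * ((e * x) ^ (1 - p)) * g2 * M :=
    mul_le_mul_of_nonneg_left (hM k).2.2.2 (by positivity)
  simp
  linarith

end GwS


namespace GwS
variable {Ω : Type*} [MeasurableSpace Ω] {μ : Measure Ω} {ξ : ℕ → ℕ → Ω → ℕ}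
    {Z : ℕ → Ω → ℕ} {m p : ℝ}

set_option maxHeartbeats 1000000 in
lemma lemL (h : GwS μ ξ Z m p) (e η : ℝ) (he : 0 < e) (he1 : e ≤ 1) (hη : 0 < η) :
    ∃ x0 : ℝ, 1 ≤ x0 ∧ ∀ (n : ℕ) (x : ℝ), x0 ≤ x →
      (1 - η) * μ.real {ω | (1 + e) * (m * x) < (ξ 0 0 ω : ℝ)}
        + (1 - η) * (m * μ.real {ω | m * x < (Z n ω : ℝ) / m ^ n})
      ≤ μ.real {ω | x < (Z (n + 1) ω : ℝ) / m ^ (n + 1)} := by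
  have := h.prob
  have hp1 := h.hp1
  have hp2 := h.hp2
  have hm1 := h.hm1
  have hm0 : 0 < m := by linarith
  obtain ⟨M, hM⟩ := h.moments
  have hM0 : 0 ≤ M := le_trans (integral_nonneg fun ω => by positivity) (hM 0).2.2.2
  set b := (e / 4) / (M + 1) with hb
  have hb0 : 0 < b := by positivity
  set l := b ^ (1 / (p - 1)) with hl
  have hl0 : 0 < l := by positivity
  have hlp : l ^ (p - 1) = b := by
    rw [hl, ← Real.rpow_mul hb0.le, one_div, inv_mul_cancel₀ (by linarith), Real.rpow_one]
  have hlM : l ^ p * M ≤ l * (e / 4) := by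
    have e1 : l ^ p = l * b := by
      rw [← hlp]
      conv_rhs => rw [← Real.rpow_one l, ← Real.rpow_mul hl0.le, ← Real.rpow_add hl0]
      congr 1; ring
    have e2 : b * M ≤ e / 4 := by
      rw [hb, div_mul_eq_mul_div, div_le_iff₀ (by linarith)]
      nlinarith
    rw [e1, mul_assoc]
    exact mul_le_mul_of_nonneg_left e2 hl0.le
  have t1 : Tendsto (fun y : ℝ => Real.exp (-(l * e / 2 * y))) atTop (nhds 0) :=
    Real.tendsto_exp_neg_atTop_nhds_zero.comp
      (tendsto_id.const_mul_atTop (by positivity : 0 < l * e / 2))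
  have t2 : Tendsto (fun y : ℝ => y ^ (-(p - 1)) * (2 * m ^ p * M)) atTop (nhds 0) := by
    have := (tendsto_rpow_neg_atTop (by linarith : 0 < p - 1)).mul_const (2 * m ^ p * M)
    rwa [zero_mul] at this
  have hηm : 0 < η * m := by positivity
  obtain ⟨x0, hx0⟩ := eventually_atTop.1 ((t1.eventually_le_const hη).and
    (t2.eventually_le_const hηm))
  refine ⟨max x0 1, le_max_right _ _, fun n x hx => ?_⟩
  have hx1 : 1 ≤ x := (le_max_right _ _).trans hx
  have hxx0 : x0 ≤ x := (le_max_left _ _).trans hx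
  set y := m * x with hy
  have hxy : x ≤ y := by rw [hy]; nlinarith
  have hy0 : 0 < y := by linarith
  obtain ⟨hy1, hy2⟩ := hx0 y (hxx0.trans hxy)
  have hI := h.iid_of n (hM n).1 (hM n).2.1 (hM n).2.2.1 (hM n).2.2.2
  have ht := h.tail n 1 x
  rw [pow_one, ← hy] at ht
  rw [ht.2]
  set P := Measure.infinitePi fun _ : ℕ => μ with hP
  have hPp : IsProbabilityMeasure P := hI.prob
  set g := μ.real {ω | y < (Z n ω : ℝ) / m ^ n} with hg
  have hg0 : 0 ≤ g := measureReal_nonneg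
  have hgy : g ≤ 1 / y := by
    have h1 := mul_meas_ge_le_integral_of_nonneg (μ := μ)
      (f := fun ω => (Z n ω : ℝ) / m ^ n) (Eventually.of_forall fun ω => by positivity)
      (hM n).1 y
    rw [(hM n).2.1] at h1
    have h2 : g ≤ μ.real {ω | y ≤ (Z n ω : ℝ) / m ^ n} := by
      refine measureReal_mono (fun ω hω => ?_)
      have hω2 : y < (Z n ω : ℝ) / m ^ n := hω
      exact hω2.le
    rw [le_div_iff₀ hy0]
    calc g * y = y * g := mul_comm _ _
      _ ≤ y * μ.real {ω | y ≤ (Z n ω : ℝ) / m ^ n} := by gcongr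
      _ ≤ 1 := h1
  set A := {ω | (1 + e) * y < (ξ 0 0 ω : ℝ)} with hA
  have hAm : MeasurableSet A :=
    measurableSet_lt measurable_const (measurable_from_top.comp (h.hmeas 0 0))
  have hiA : Integrable (A.indicator (1 : Ω → ℝ)) μ :=
    (integrable_indicator_iff hAm).2 (integrable_const _).integrableOn
  have hb : ∀ ω, (1 - η) * A.indicator (1 : Ω → ℝ) ω + g * (ξ 0 0 ω : ℝ)
      + (-(g * (2 * y ^ (1 - p)))) * (ξ 0 0 ω : ℝ) ^ p ≤
      P.real {ω' | y < ∑ i ∈ Finset.range (Z 1 ω), (Z n (ω' i) : ℝ) / m ^ n} := by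
    intro ω
    rw [h.Z1]
    set N := ξ 0 0 ω with hN
    have hyp : 0 < y ^ (1 - p) := by positivity
    have hq0 : 0 ≤ P.real {ω' | y < ∑ i ∈ Finset.range N, (Z n (ω' i) : ℝ) / m ^ n} :=
      measureReal_nonneg
    by_cases hωA : ω ∈ A
    · rw [Set.indicator_of_mem hωA, Pi.one_apply]
      have hNy : (1 + e) * y < (N : ℝ) := hωA
      have hN0 : 0 < (N : ℝ) := lt_trans (by positivity) hNy
      have hyN : y ≤ N := by nlinarith
      have s1 : (N : ℝ) ≤ N ^ p * y ^ (1 - p) := by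
        have : (N : ℝ) ^ p * N ^ (1 - p) = N := by
          rw [← Real.rpow_add hN0]; simp
        calc (N : ℝ) = N ^ p * N ^ (1 - p) := this.symm
          _ ≤ _ := mul_le_mul_of_nonneg_left
            (Real.rpow_le_rpow_of_nonpos hy0 hyN (by linarith)) (by positivity)
      have s2 : 1 - η ≤ P.real {ω' | y < ∑ i ∈ Finset.range N, (Z n (ω' i) : ℝ) / m ^ n} := by
        have hset : MeasurableSet
            {ω' : ℕ → Ω | y < ∑ i ∈ Finset.range N, (Z n (ω' i) : ℝ) / m ^ n} := by
          refine measurableSet_lt measurable_const (Finset.measurable_fun_sum _ fun i _ => ?_)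
          exact (measurable_from_top.comp ((h.measZ n).comp (measurable_pi_apply i))).div_const _
        have l1 := hI.lower (a := y) hl0.le N
        have l2 : {ω' : ℕ → Ω | ∑ i ∈ Finset.range N, (Z n (ω' i) : ℝ) / m ^ n ≤ y} =
          {ω' : ℕ → Ω | y < ∑ i ∈ Finset.range N, (Z n (ω' i) : ℝ) / m ^ n}ᶜ := by
          ext ω'; simp
        rw [l2, probReal_compl_eq_one_sub hset] at l1
        have l3 : l * y + N * (-l + l ^ p * M) ≤ -(l * e / 2 * y) := by
          have q1 : (N : ℝ) * (-l + l ^ p * M) ≤ N * (-(l * (1 - e / 4))) :=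
            mul_le_mul_of_nonneg_left (by linarith) hN0.le
          have q2 : (1 + e) * y * (l * (1 - e / 4)) ≤ N * (l * (1 - e / 4)) :=
            mul_le_mul_of_nonneg_right hNy.le (mul_nonneg hl0.le (by linarith))
          have q3 : 0 ≤ l * y * (e * (1 - e)) := by
            have : 0 ≤ 1 - e := by linarith
            positivity
          nlinarith
        have l4 := (l1.trans (Real.exp_le_exp.2 l3)).trans hy1
        linarith
      have s3 : g * N ≤ g * (N ^ p * y ^ (1 - p)) := mul_le_mul_of_nonneg_left s1 hg0
      have s4 : 0 ≤ g * ((N : ℝ) ^ p * y ^ (1 - p)) := by positivity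
      have s5 : -(g * (2 * y ^ (1 - p))) * (N : ℝ) ^ p = -2 * (g * (N ^ p * y ^ (1 - p))) := by ring
      rw [s5]
      linarith
    · rw [Set.indicator_of_notMem hωA]
      have hNy : (N : ℝ) ≤ (1 + e) * y := not_lt.1 hωA
      have j1 := hI.lower_jump y N
      rw [h.tail0] at j1
      simp only [← hg] at j1
      have s1 : (N : ℝ) ^ 2 * g ≤ 2 * y ^ (1 - p) * N ^ p := by
        rcases (Nat.cast_nonneg N : (0 : ℝ) ≤ N).eq_or_lt with h0 | h0
        · rw [← h0]; simp; positivity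
        · have r1 : (N : ℝ) ^ 2 = N ^ p * N ^ (2 - p) := by
            rw [← Real.rpow_add h0, ← Real.rpow_two]; congr 1; ring
          have r2 : (N : ℝ) ^ (2 - p) ≤ 2 * y ^ (2 - p) := by
            calc (N : ℝ) ^ (2 - p) ≤ (2 * y) ^ (2 - p) :=
                  Real.rpow_le_rpow h0.le (by nlinarith) (by linarith)
              _ = 2 ^ (2 - p) * y ^ (2 - p) := Real.mul_rpow (by norm_num) hy0.le
              _ ≤ 2 ^ (1 : ℝ) * y ^ (2 - p) := by
                gcongr
                · norm_num
                · linarith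
              _ = _ := by rw [Real.rpow_one]
          have r3 : y ^ (2 - p) * (1 / y) = y ^ (1 - p) := by
            rw [one_div, ← Real.rpow_neg_one y, ← Real.rpow_add hy0]; congr 1; ring
          calc (N : ℝ) ^ 2 * g ≤ (N ^ p * (2 * y ^ (2 - p))) * (1 / y) := by
                rw [r1]; gcongr
            _ = 2 * (y ^ (2 - p) * (1 / y)) * N ^ p := by ring
            _ = _ := by rw [r3]
      have s2 : g * ((N : ℝ) ^ 2 * g) ≤ g * (2 * y ^ (1 - p) * N ^ p) :=
        mul_le_mul_of_nonneg_left s1 hg0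
      have s3 : ((N : ℝ) * g) ^ 2 = g * ((N : ℝ) ^ 2 * g) := by ring
      have s5 : -(g * (2 * y ^ (1 - p))) * (N : ℝ) ^ p = -(g * (2 * y ^ (1 - p) * N ^ p)) := by ring
      rw [s3] at j1
      rw [s5]
      linarith
  have i1 := h.hint.const_mul g
  have i2 := h.hintp.const_mul (-(g * (2 * y ^ (1 - p))))
  have i3 := gw_int3 (hiA.const_mul (1 - η)) i1 i2
  refine le_trans ?_ (integral_mono i3.1 ht.1 hb)
  rw [i3.2, integral_const_mul, integral_const_mul, integral_const_mul, h.hm,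
    integral_indicator_one hAm]
  have k1 : ∫ ω, (ξ 0 0 ω : ℝ) ^ p ∂μ ≤ m ^ p * M := by
    have k2 := (hM 1).2.2.2
    have k3 : ∀ ω, ((Z 1 ω : ℝ) / m ^ 1) ^ p = (ξ 0 0 ω : ℝ) ^ p / m ^ p := fun ω => by
      rw [h.Z1, pow_one, Real.div_rpow (by positivity) hm0.le]
    simp only [k3] at k2
    rw [integral_div, div_le_iff₀ (by positivity)] at k2
    linarith
  rw [show -(p - 1) = 1 - p by ring] at hy2
  have k4 : g * (2 * y ^ (1 - p)) * ∫ ω, (ξ 0 0 ω : ℝ) ^ p ∂μ ≤ g * (η * m) := by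
    calc g * (2 * y ^ (1 - p)) * ∫ ω, (ξ 0 0 ω : ℝ) ^ p ∂μ
        ≤ g * (2 * y ^ (1 - p)) * (m ^ p * M) := by gcongr
      _ = g * (y ^ (1 - p) * (2 * m ^ p * M)) := by ring
      _ ≤ _ := by gcongr
  linarith

end GwS


lemma gw_crude {F : ℝ → ℝ} {δ m κ D C : ℝ} {G : ℕ → ℝ → ℝ} (h : GwF F δ) (hm1 : 1 < m)
    (hκ : 0 < κ) (hκ1 : κ < 1) (hD : 0 ≤ D) (hC : 0 ≤ C)
    (hG1 : ∀ n x, G n x ≤ 1) (hG0 : ∀ x, 1 ≤ x → G 0 x ≤ 0) (hGF : ∀ x, G 1 x ≤ F (m * x))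
    (hrec : ∀ (n k : ℕ) (x : ℝ), 1 ≤ x →
      G (n + k) x ≤ G k (1 / 2 * x) + D * m ^ k * G n (κ * m ^ k * x) + C * F x) :
    ∃ A : ℝ, 0 ≤ A ∧ ∀ n x, G n x ≤ A * F x := by
  have hm0 : 0 < m := by linarith
  have small : ∀ (a A : ℝ), 1 / F a ≤ A → ∀ n x, x ≤ a → G n x ≤ A * F x := by
    intro a A hA n x hx
    have h1 : F a ≤ F x := h.anti hx
    have h2 : 0 < F a := h.pos a
    calc G n x ≤ 1 := hG1 n x
      _ = 1 / F a * F a := by field_simp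
      _ ≤ A * F x := mul_le_mul hA h1 h2.le (le_trans (by positivity) hA)
  have step1 : ∀ n, ∃ A : ℝ, 0 ≤ A ∧ ∀ x, G n x ≤ A * F x := by
    intro n
    induction n with
    | zero =>
      have h2 : 0 < F 1 := h.pos 1
      refine ⟨1 / F 1, by positivity, fun x => ?_⟩
      rcases le_total x 1 with hx | hx
      · exact small 1 _ le_rfl 0 x hx
      · exact (hG0 x hx).trans (mul_nonneg (by positivity) (h.pos x).le)
    | succ n ih =>
      obtain ⟨A, hA0, hA⟩ := ih
      obtain ⟨C1, hC1, hs1⟩ := h.scale (κ := m * (1 / 2)) (by positivity)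
      obtain ⟨C2, hC2, hs2⟩ := h.scale (κ := κ * m ^ 1) (by positivity)
      have h2 : 0 < F 1 := h.pos 1
      have hnn : 0 ≤ C1 + D * m ^ 1 * (A * C2) + C := by positivity
      refine ⟨1 / F 1 + (C1 + D * m ^ 1 * (A * C2) + C), by positivity, fun x => ?_⟩
      rcases le_total x 1 with hx | hx
      · exact small 1 _ (by linarith) (n + 1) x hx
      · have r := hrec n 1 x hx
        have r1 : G 1 (1 / 2 * x) ≤ C1 * F x := by
          refine (hGF _).trans ?_
          rw [← mul_assoc]
          exact hs1 x (by linarith)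
        have r2 : D * m ^ 1 * G n (κ * m ^ 1 * x) ≤ D * m ^ 1 * (A * (C2 * F x)) := by
          refine mul_le_mul_of_nonneg_left ?_ (by positivity)
          exact (hA _).trans (mul_le_mul_of_nonneg_left (hs2 x (by linarith)) hA0)
        have r3 : 0 ≤ 1 / F 1 * F x := mul_nonneg (by positivity) (h.pos x).le
        linarith [show (1 / F 1 + (C1 + D * m ^ 1 * (A * C2) + C)) * F x =
          1 / F 1 * F x + C1 * F x + D * m ^ 1 * (A * (C2 * F x)) + C * F x by ring]
  obtain ⟨c, hc⟩ := h.hC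
  have hδ := h.hδ
  set c' := max c 0 with hc'
  have hc'0 : 0 ≤ c' := le_max_right _ _
  have hk1 : ∀ᶠ k : ℕ in atTop, 1 < κ * m ^ k := by
    have : Tendsto (fun k : ℕ => κ * m ^ k) atTop atTop :=
      (tendsto_pow_atTop_atTop_of_one_lt hm1).const_mul_atTop hκ
    exact this.eventually_gt_atTop 1
  have hk2 : ∀ᶠ k : ℕ in atTop, D / κ ^ (1 + δ) * c' * (m ^ k) ^ (-δ) ≤ 1 / 2 := by
    have t1 : Tendsto (fun k : ℕ => (m ^ k) ^ (-δ)) atTop (nhds 0) :=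
      (tendsto_rpow_neg_atTop hδ).comp (tendsto_pow_atTop_atTop_of_one_lt hm1)
    have t2 := t1.const_mul (D / κ ^ (1 + δ) * c')
    rw [mul_zero] at t2
    exact t2.eventually_le_const (by norm_num)
  obtain ⟨k, hk, hkk⟩ := (hk1.and hk2).exists
  have hk0 : 0 < k := by
    rcases Nat.eq_zero_or_pos k with h0 | h0
    · subst h0; simp at hk; linarith
    · exact h0
  have hmk : 0 < m ^ k := by positivity
  have hcon : D * m ^ k * (c' / (κ * m ^ k) ^ (1 + δ)) ≤ 1 / 2 := by
    have : D * m ^ k * (c' / (κ * m ^ k) ^ (1 + δ)) = D / κ ^ (1 + δ) * c' * (m ^ k) ^ (-δ) := by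
      rw [Real.mul_rpow hκ.le hmk.le, Real.rpow_neg hmk.le, Real.rpow_add hmk, Real.rpow_one]
      field_simp
    rw [this]; exact hkk
  choose Aj hAj0 hAj using step1
  obtain ⟨C3, hC3, hs3⟩ := h.scale (κ := 1 / 2) (by norm_num)
  have h2 : 0 < F 2 := h.pos 2
  have hS : 0 ≤ ∑ j ∈ Finset.range k, Aj j := Finset.sum_nonneg fun j _ => hAj0 j
  have hE : 0 ≤ Aj k * C3 + C := by have := hAj0 k; positivity
  set A := 1 / F 2 + 2 * (Aj k * C3 + C) + ∑ j ∈ Finset.range k, Aj j with hA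
  have hF2 : 0 ≤ 1 / F 2 := by positivity
  have hA0 : 0 ≤ A := by rw [hA]; linarith
  refine ⟨A, hA0, fun n => ?_⟩
  induction n using Nat.strong_induction_on with
  | _ n ih =>
    intro x
    by_cases hnk : n < k
    · refine (hAj n x).trans (mul_le_mul_of_nonneg_right ?_ (h.pos x).le)
      have := Finset.single_le_sum (f := Aj) (fun j _ => hAj0 j) (Finset.mem_range.2 hnk)
      rw [hA]; linarith
    · rcases le_total x 2 with hx | hx
      · exact small 2 A (by rw [hA]; linarith) n x hx
      · obtain ⟨j, rfl⟩ := Nat.exists_eq_add_of_le' (not_lt.1 hnk)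
        have r := hrec j k x (by linarith)
        have r1 : G k (1 / 2 * x) ≤ Aj k * (C3 * F x) :=
          (hAj k _).trans (mul_le_mul_of_nonneg_left (hs3 x (by linarith)) (hAj0 k))
        have r2 : G j (κ * m ^ k * x) ≤ A * (c' / (κ * m ^ k) ^ (1 + δ) * F x) := by
          refine (ih j (by omega) _).trans (mul_le_mul_of_nonneg_left ?_ hA0)
          have q := hc x (by linarith) (κ * m ^ k) hk
          rw [mul_comm x] at q
          refine q.trans ?_
          rw [div_mul_eq_mul_div]
          refine div_le_div_of_nonneg_right ?_ (by positivity)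
          exact mul_le_mul_of_nonneg_right (le_max_left _ _) (h.pos x).le
        have r3 : D * m ^ k * G j (κ * m ^ k * x) ≤ A * (1 / 2 * F x) := by
          calc D * m ^ k * G j (κ * m ^ k * x)
              ≤ D * m ^ k * (A * (c' / (κ * m ^ k) ^ (1 + δ) * F x)) :=
                mul_le_mul_of_nonneg_left r2 (by positivity)
            _ = A * (D * m ^ k * (c' / (κ * m ^ k) ^ (1 + δ)) * F x) := by ring
            _ ≤ _ := mul_le_mul_of_nonneg_left
              (mul_le_mul_of_nonneg_right hcon (h.pos x).le) hA0
        have r4 : (Aj k * C3 + C) * F x ≤ A * (1 / 2) * F x :=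
          mul_le_mul_of_nonneg_right (by rw [hA]; linarith) (h.pos x).le
        linarith

lemma GwS.crude {Ω : Type*} [MeasurableSpace Ω] {μ : Measure Ω} {ξ : ℕ → ℕ → Ω → ℕ}
    {Z : ℕ → Ω → ℕ} {m p : ℝ} (h : GwS μ ξ Z m p) {F : ℝ → ℝ} {δ : ℝ} (hF : GwF F δ)
    (hFd : ∀ x, F x = μ.real {ω | x < (ξ 0 0 ω : ℝ)}) :
    ∃ A : ℝ, 0 ≤ A ∧ ∀ n x, μ.real {ω | x < (Z n ω : ℝ) / m ^ n} ≤ A * F x := by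
  have := h.prob
  have hp1 := h.hp1
  have hp2 := h.hp2
  have hm1 := h.hm1
  have hm0 : 0 < m := by linarith
  obtain ⟨M, hM0, hM⟩ := h.lemU
  obtain ⟨β, c, hβ, hc, hpl⟩ := hF.poly_lower
  obtain ⟨κ, C, hκ, hκ1, hC, hU⟩ := hM (1 / 2) β (by norm_num) (by norm_num) hβ
  have hanti : ∀ n, Antitone fun x => μ.real {ω | x < (Z n ω : ℝ) / m ^ n} := by
    intro n a b hab
    exact measureReal_mono fun ω hω => lt_of_le_of_lt hab hω
  refine gw_crude (m := m) (κ := min κ (1 / 2)) (D := 1 + 2 * M) (C := C / c) hF hm1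
    (lt_min hκ (by norm_num)) (lt_of_le_of_lt (min_le_left _ _) hκ1) (by positivity) (by positivity)
    (fun n x => measureReal_le_one) ?_ ?_ ?_
  · intro x hx
    have : {ω | x < (Z 0 ω : ℝ) / m ^ 0} = ∅ := by
      ext ω; simp [h.hZ0, hx]
    rw [this]; simp
  · intro x
    rw [hFd]
    refine measureReal_mono fun ω hω => ?_
    have hω2 : x < (Z 1 ω : ℝ) / m ^ 1 := hω
    rw [h.Z1, pow_one, lt_div_iff₀ hm0, mul_comm] at hω2
    exact hω2
  · intro n k x hx
    have hx0 : 0 < x := by linarith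
    have r := hU n k x hx
    have q1 : μ.real {ω | (1 - 1 / 2) * (m ^ k * x) < (Z n ω : ℝ) / m ^ n} ≤
        μ.real {ω | min κ (1 / 2) * m ^ k * x < (Z n ω : ℝ) / m ^ n} := by
      refine hanti n ?_
      rw [mul_assoc]
      refine mul_le_mul_of_nonneg_right ?_ (by positivity)
      exact (min_le_right _ _).trans (by norm_num)
    have q2 : μ.real {ω | κ * (m ^ k * x) < (Z n ω : ℝ) / m ^ n} ≤
        μ.real {ω | min κ (1 / 2) * m ^ k * x < (Z n ω : ℝ) / m ^ n} := by
      refine hanti n ?_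
      rw [mul_assoc]
      exact mul_le_mul_of_nonneg_right (min_le_left _ _) (by positivity)
    have q3 : (1 / 2 * x) ^ (1 - p) ≤ 2 := by
      calc (1 / 2 * x) ^ (1 - p) ≤ (1 / 2 : ℝ) ^ (1 - p) :=
            Real.rpow_le_rpow_of_nonpos (by norm_num) (by linarith) (by linarith)
        _ ≤ (1 / 2 : ℝ) ^ (-1 : ℝ) :=
            Real.rpow_le_rpow_of_exponent_ge (by norm_num) (by norm_num) (by linarith)
        _ = 2 := by rw [Real.rpow_neg_one]; norm_num
    have q4 : C * x ^ (-β) ≤ C / c * F x := by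
      have := hpl x hx
      calc C * x ^ (-β) = C / c * (c * x ^ (-β)) := by field_simp
        _ ≤ _ := mul_le_mul_of_nonneg_left this (by positivity)
    set g := μ.real {ω | min κ (1 / 2) * m ^ k * x < (Z n ω : ℝ) / m ^ n} with hg
    have hg0 : 0 ≤ g := measureReal_nonneg
    have q5 : m ^ k * (M * (1 / 2 * x) ^ (1 - p)) *
        μ.real {ω | κ * (m ^ k * x) < (Z n ω : ℝ) / m ^ n} ≤ m ^ k * (M * 2) * g := by
      gcongr
    have q6 : m ^ k * μ.real {ω | (1 - 1 / 2) * (m ^ k * x) < (Z n ω : ℝ) / m ^ n} ≤ m ^ k * g := by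
      gcongr
    rw [show (1 - 1 / 2 : ℝ) = 1 / 2 by norm_num] at r q6
    linarith


lemma gw_lim {Ω : Type*} [MeasurableSpace Ω] {μ : Measure Ω} [IsProbabilityMeasure μ]
    {f : ℕ → Ω → ℝ} {g : Ω → ℝ} (hf : ∀ n, Measurable (f n))
    (hlim : ∀ᵐ ω ∂μ, Tendsto (fun n => f n ω) atTop (nhds (g ω))) {a b η : ℝ} (hab : a < b)
    (hη : 0 < η) : ∀ᶠ n in atTop, μ.real {ω | b < g ω} ≤ μ.real {ω | a < f n ω} + η ∧
      μ.real {ω | b < f n ω} ≤ μ.real {ω | a < g ω} + η := by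
  have ht := tendstoInMeasure_of_tendsto_ae (fun n => (hf n).aestronglyMeasurable) hlim
  rw [tendstoInMeasure_iff_measureReal_dist] at ht
  have ht2 := (ht (b - a) (by linarith)).eventually_le_const hη
  filter_upwards [ht2] with n hn
  constructor
  · calc μ.real {ω | b < g ω} ≤ μ.real ({ω | a < f n ω} ∪ {ω | b - a ≤ dist (f n ω) (g ω)}) := by
          refine measureReal_mono fun ω hω => ?_
          have hω2 : b < g ω := hω
          by_cases hc : a < f n ω
          · exact Or.inl hc
          · right
            change b - a ≤ dist (f n ω) (g ω)
            rw [Real.dist_eq, abs_sub_comm]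
            have := le_abs_self (g ω - f n ω)
            linarith
      _ ≤ _ := (measureReal_union_le _ _).trans (by linarith)
  · calc μ.real {ω | b < f n ω} ≤ μ.real ({ω | a < g ω} ∪ {ω | b - a ≤ dist (f n ω) (g ω)}) := by
          refine measureReal_mono fun ω hω => ?_
          have hω2 : b < f n ω := hω
          by_cases hc : a < g ω
          · exact Or.inl hc
          · right
            change b - a ≤ dist (f n ω) (g ω)
            rw [Real.dist_eq]
            have := le_abs_self (f n ω - g ω)
            linarith
      _ ≤ _ := (measureReal_union_le _ _).trans (by linarith)

namespace GwS
variable {Ω : Type*} [MeasurableSpace Ω] {μ : Measure Ω} {ξ : ℕ → ℕ → Ω → ℕ}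
    {Z : ℕ → Ω → ℕ} {m p : ℝ}

lemma limZ (h : GwS μ ξ Z m p) {Wl : Ω → ℝ}
    (hlim : ∀ᵐ ω ∂μ, Tendsto (fun n => (Z n ω : ℝ) / m ^ n) atTop (nhds (Wl ω)))
    {a b η : ℝ} (hab : a < b) (hη : 0 < η) :
    ∀ᶠ n in atTop, μ.real {ω | b < Wl ω} ≤ μ.real {ω | a < (Z n ω : ℝ) / m ^ n} + η ∧
      μ.real {ω | b < (Z n ω : ℝ) / m ^ n} ≤ μ.real {ω | a < Wl ω} + η := by
  have := h.prob
  exact gw_lim (f := fun n ω => (Z n ω : ℝ) / m ^ n)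
    (fun n => (measurable_from_top.comp (h.measZ n)).div_const _) hlim hab hη

lemma crudeW (h : GwS μ ξ Z m p) {F : ℝ → ℝ} {δ : ℝ} (hF : GwF F δ)
    (hFd : ∀ x, F x = μ.real {ω | x < (ξ 0 0 ω : ℝ)}) {Wl : Ω → ℝ}
    (hlim : ∀ᵐ ω ∂μ, Tendsto (fun n => (Z n ω : ℝ) / m ^ n) atTop (nhds (Wl ω))) :
    ∃ A : ℝ, 0 ≤ A ∧ ∀ x, 0 < x → μ.real {ω | x < Wl ω} ≤ A * F x := by
  obtain ⟨A, hA0, hA⟩ := h.crude hF hFd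
  obtain ⟨C, hC, hs⟩ := hF.scale (κ := 1 / 2) (by norm_num)
  refine ⟨A * C, by positivity, fun x hx => le_of_forall_pos_le_add fun η hη => ?_⟩
  obtain ⟨n, hn⟩ := (h.limZ hlim (a := 1 / 2 * x) (b := x) (by linarith) hη).exists
  have h1 := hA n (1 / 2 * x)
  have h2 : A * F (1 / 2 * x) ≤ A * (C * F x) := mul_le_mul_of_nonneg_left (hs x hx.le) hA0
  linarith [hn.1]

lemma Rplus (h : GwS μ ξ Z m p) {F : ℝ → ℝ} {δ : ℝ} (hF : GwF F δ)
    (hFd : ∀ x, F x = μ.real {ω | x < (ξ 0 0 ω : ℝ)}) {Wl : Ω → ℝ}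
    (hlim : ∀ᵐ ω ∂μ, Tendsto (fun n => (Z n ω : ℝ) / m ^ n) atTop (nhds (Wl ω)))
    (e η : ℝ) (he : 0 < e) (he1 : e < 1) (hη : 0 < η) :
    ∀ᶠ x in atTop, μ.real {ω | x < Wl ω} ≤
      F ((1 - e) * (m * x)) + m * μ.real {ω | (1 - e) * (m * x) < Wl ω} + η * F x := by
  have := h.prob
  have hp1 := h.hp1
  have hp2 := h.hp2
  have hm1 := h.hm1
  have hm0 : 0 < m := by linarith
  obtain ⟨A, hA0, hA⟩ := h.crude hF hFd
  obtain ⟨M, hM0, hM⟩ := h.lemU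
  obtain ⟨β, c, hβ, hc, hpl⟩ := hF.poly_lower
  obtain ⟨κ, C, hκ, hκ1, hC, hU⟩ := hM (e / 2) (β + 1) (by linarith) (by linarith) (by linarith)
  set q := 1 - e / 2 with hq
  have hq0 : 0 < q := by rw [hq]; linarith
  obtain ⟨C1, hC1, hs1⟩ := hF.scale (κ := κ * m * q) (by positivity)
  obtain ⟨C2, hC2, hs2⟩ := hF.scale (κ := q) hq0
  have t0 : Tendsto (fun x : ℝ => q * x) atTop atTop := tendsto_id.const_mul_atTop hq0
  have t1 : Tendsto (fun x : ℝ => m * (M * (e / 2 * (q * x)) ^ (-(p - 1))) * (A * C1)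
      + C / c * (q * x)⁻¹ * C2) atTop (nhds 0) := by
    have a1 : Tendsto (fun x : ℝ => (e / 2 * (q * x)) ^ (-(p - 1))) atTop (nhds 0) :=
      (tendsto_rpow_neg_atTop (by linarith : 0 < p - 1)).comp
        (t0.const_mul_atTop (by linarith : 0 < e / 2))
    have a2 : Tendsto (fun x : ℝ => (q * x)⁻¹) atTop (nhds 0) := tendsto_inv_atTop_zero.comp t0
    have := (((a1.const_mul M).const_mul m).mul_const (A * C1)).add
      ((a2.const_mul (C / c)).mul_const C2)
    simpa using this
  filter_upwards [t1.eventually_le_const hη, t0.eventually_ge_atTop 1, eventually_gt_atTop 0]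
    with x hx1 hx2 hx0
  have hmx : 0 < m * x := by positivity
  refine le_of_forall_pos_le_add fun η' hη' => ?_
  set d := η' / (1 + m) with hd
  have hd0 : 0 < d := by positivity
  have hab1 : q * x < x := by rw [hq]; nlinarith
  have hab2 : (1 - e) * (m * x) < q * (m * (q * x)) := by
    have : 1 - e < q * q := by rw [hq]; nlinarith
    calc (1 - e) * (m * x) < (q * q) * (m * x) := mul_lt_mul_of_pos_right this hmx
      _ = _ := by ring
  have ev1 := h.limZ hlim hab1 hd0
  have ev2 := h.limZ hlim hab2 hd0
  obtain ⟨n, hn1, hn2⟩ := (((tendsto_add_atTop_nat 1).eventually ev1).and ev2).exists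
  have r := hU n 1 (q * x) hx2
  rw [pow_one] at r
  have w1 : μ.real {ω | (1 - e / 2) * (q * x) < (Z 1 ω : ℝ) / m ^ 1} ≤ F ((1 - e) * (m * x)) := by
    rw [hFd]
    refine measureReal_mono fun ω hω => ?_
    have hω2 : q * (q * x) < (Z 1 ω : ℝ) / m ^ 1 := hω
    rw [h.Z1, pow_one, lt_div_iff₀ hm0] at hω2
    change (1 - e) * (m * x) < (ξ 0 0 ω : ℝ)
    linarith [show q * (m * (q * x)) = q * (q * x) * m by ring]
  rw [pow_one] at w1
  have w2 : m * (M * (e / 2 * (q * x)) ^ (1 - p)) *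
      μ.real {ω | κ * (m * (q * x)) < (Z n ω : ℝ) / m ^ n} ≤
      m * (M * (e / 2 * (q * x)) ^ (-(p - 1))) * (A * C1) * F x := by
    rw [show 1 - p = -(p - 1) by ring]
    have v1 := hA n (κ * (m * (q * x)))
    have v2 := hs1 x hx0.le
    rw [show κ * m * q * x = κ * (m * (q * x)) by ring] at v2
    have v3 : A * F (κ * (m * (q * x))) ≤ A * (C1 * F x) := mul_le_mul_of_nonneg_left v2 hA0
    calc _ ≤ m * (M * (e / 2 * (q * x)) ^ (-(p - 1))) * (A * (C1 * F x)) :=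
          mul_le_mul_of_nonneg_left (v1.trans v3) (by positivity)
      _ = _ := by ring
  have w3 : C * (q * x) ^ (-(β + 1)) ≤ C / c * (q * x)⁻¹ * C2 * F x := by
    have v1 := hpl (q * x) hx2
    have hqx : 0 < q * x := by linarith
    have v2 : (q * x) ^ (-(β + 1)) = (q * x) ^ (-β) * (q * x)⁻¹ := by
      rw [← Real.rpow_neg_one (q * x), ← Real.rpow_add hqx]; congr 1; ring
    rw [v2]
    calc C * ((q * x) ^ (-β) * (q * x)⁻¹) = C / c * (q * x)⁻¹ * (c * (q * x) ^ (-β)) := by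
          field_simp
      _ ≤ C / c * (q * x)⁻¹ * (C2 * F x) :=
          mul_le_mul_of_nonneg_left (v1.trans (hs2 x hx0.le)) (by positivity)
      _ = _ := by ring
  have w4 := mul_le_mul_of_nonneg_right hx1 (hF.pos x).le
  rw [add_mul] at w4
  have w5 : m * μ.real {ω | (1 - e / 2) * (m * (q * x)) < (Z n ω : ℝ) / m ^ n} ≤
      m * (μ.real {ω | (1 - e) * (m * x) < Wl ω} + d) :=
    mul_le_mul_of_nonneg_left hn2.2 hm0.le
  have w6 : d + m * d = η' := by rw [hd]; field_simp
  linarith [hn1.1]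

lemma Rminus (h : GwS μ ξ Z m p) {F : ℝ → ℝ} {δ : ℝ} (hF : GwF F δ)
    (hFd : ∀ x, F x = μ.real {ω | x < (ξ 0 0 ω : ℝ)}) {Wl : Ω → ℝ}
    (hlim : ∀ᵐ ω ∂μ, Tendsto (fun n => (Z n ω : ℝ) / m ^ n) atTop (nhds (Wl ω)))
    (e η : ℝ) (he : 0 < e) (he1 : e < 1) (hη : 0 < η) (hη1 : η < 1) :
    ∀ᶠ x in atTop, (1 - η) * (F ((1 + e) * (m * x)) + m * μ.real {ω | (1 + e) * (m * x) < Wl ω})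
      ≤ μ.real {ω | x < Wl ω} := by
  have := h.prob
  have hm1 := h.hm1
  have hm0 : 0 < m := by linarith
  obtain ⟨x0, hx01, hL⟩ := h.lemL (e / 4) η (by linarith) (by linarith) hη
  set q := 1 + e / 4 with hq
  have hq0 : 0 < q := by rw [hq]; linarith
  have t0 : Tendsto (fun x : ℝ => q * x) atTop atTop := tendsto_id.const_mul_atTop hq0
  filter_upwards [t0.eventually_ge_atTop x0, eventually_gt_atTop 0] with x hx1 hx0
  have hmx : 0 < m * x := by positivity
  refine le_of_forall_pos_le_add fun η' hη' => ?_
  set d := η' / (1 + m) with hd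
  have hd0 : 0 < d := by positivity
  have hab1 : x < q * x := by rw [hq]; nlinarith
  have hab2 : m * (q * x) < (1 + e) * (m * x) := by
    have : q < 1 + e := by rw [hq]; linarith
    calc m * (q * x) = q * (m * x) := by ring
      _ < _ := mul_lt_mul_of_pos_right this hmx
  have ev1 := h.limZ hlim hab1 hd0
  have ev2 := h.limZ hlim hab2 hd0
  obtain ⟨n, hn1, hn2⟩ := (((tendsto_add_atTop_nat 1).eventually ev1).and ev2).exists
  have r := hL n (q * x) hx1
  rw [← hFd] at r
  have w1 : F ((1 + e) * (m * x)) ≤ F (q * (m * (q * x))) := by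
    refine hF.anti ?_
    have : q * q ≤ 1 + e := by rw [hq]; nlinarith
    calc q * (m * (q * x)) = (q * q) * (m * x) := by ring
      _ ≤ _ := mul_le_mul_of_nonneg_right this hmx.le
  have w2 : m * μ.real {ω | (1 + e) * (m * x) < Wl ω} ≤
      m * (μ.real {ω | m * (q * x) < (Z n ω : ℝ) / m ^ n} + d) :=
    mul_le_mul_of_nonneg_left hn2.1 hm0.le
  have w3 := mul_le_mul_of_nonneg_left (add_le_add w1 w2) (by linarith : 0 ≤ 1 - η)
  have w6 : d + m * d = η' := by rw [hd]; field_simp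
  have w7 : 0 ≤ η * (m * d) := by positivity
  linarith [hn1.2, show (1 - η) * (F (q * (m * (q * x))) + m * (μ.real {ω | m * (q * x) < (Z n ω : ℝ) / m ^ n} + d)) = (1 - η) * F (q * (m * (q * x))) + (1 - η) * (m * μ.real {ω | m * (q * x) < (Z n ω : ℝ) / m ^ n}) + m * d - η * (m * d) by ring]

end GwS


namespace GwF
variable {F : ℝ → ℝ} {δ : ℝ}

lemma irv (h : GwF F δ) (hIRV : Tendsto
      (fun ε : ℝ => Filter.liminf (fun x : ℝ => F (x * (1 + ε)) / F x) atTop)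
      (nhdsWithin 0 (Set.Ioi 0)) (nhds 1)) {η : ℝ} (hη : 0 < η) :
    ∃ e : ℝ, 0 < e ∧ e < 1 ∧ ∃ x0 : ℝ, 0 < x0 ∧ ∀ x, x0 ≤ x →
      (1 - η) * F x ≤ F ((1 + e) * x) ∧ (1 - η) * F ((1 - e) * x) ≤ F x := by
  have h1 := hIRV.eventually_const_lt (by linarith : 1 - η < 1)
  have h2 : ∀ᶠ ε : ℝ in nhdsWithin 0 (Set.Ioi 0), 0 < ε := eventually_mem_nhdsWithin
  obtain ⟨ε, hε, hε0⟩ := (h1.and h2).exists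
  have hbd : IsBoundedUnder (· ≥ ·) atTop (fun x : ℝ => F (x * (1 + ε)) / F x) := by
    refine isBoundedUnder_of ⟨0, fun x => ?_⟩
    exact (div_pos (h.pos _) (h.pos _)).le
  have h3 := eventually_lt_of_lt_liminf hε hbd
  obtain ⟨x1, hx1⟩ := eventually_atTop.1 h3
  have hx1' : ∀ x, x1 ≤ x → (1 - η) * F x ≤ F (x * (1 + ε)) := fun x hx =>
    ((lt_div_iff₀ (h.pos x)).1 (hx1 x hx)).le
  have he1 : ε / (1 + ε) < 1 := by rw [div_lt_one (by linarith)]; linarith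
  have h1e : 1 - ε / (1 + ε) = 1 / (1 + ε) := by field_simp; ring
  refine ⟨ε / (1 + ε), by positivity, he1, (1 + ε) * max x1 1, by positivity, fun x hx => ⟨?_, ?_⟩⟩
  · have hm : max x1 1 ≤ x := by
      refine le_trans ?_ hx
      have : 0 < max x1 1 := by positivity
      nlinarith
    have hx0 : 0 < x := lt_of_lt_of_le (by positivity) hm
    refine (hx1' x ((le_max_left _ _).trans hm)).trans (h.anti ?_)
    rw [mul_comm x]
    refine mul_le_mul_of_nonneg_right ?_ hx0.le
    have : ε / (1 + ε) ≤ ε := div_le_self hε0.le (by linarith)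
    linarith
  · have hm : max x1 1 ≤ (1 - ε / (1 + ε)) * x := by
      rw [h1e, one_div_mul_eq_div, le_div_iff₀ (by linarith)]; linarith
    have := hx1' _ ((le_max_left _ _).trans hm)
    rwa [show (1 - ε / (1 + ε)) * x * (1 + ε) = x by rw [h1e]; field_simp] at this

lemma summ (h : GwF F δ) {m : ℝ} (hm1 : 1 < m) :
    ∃ K : ℝ, 0 < K ∧ ∀ x, 1 < x → Summable (fun i : ℕ => m ^ i * F (m ^ (i + 1) * x)) ∧
      ∑' i : ℕ, m ^ i * F (m ^ (i + 1) * x) ≤ K * F x := by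
  have hm0 : 0 < m := by linarith
  have hδ := h.hδ
  obtain ⟨c, hc⟩ := h.hC
  set r := m ^ (-δ) with hr
  have hr0 : 0 < r := by positivity
  have hr1 : r < 1 := Real.rpow_lt_one_of_one_lt_of_neg hm1 (by linarith)
  have hg : Summable fun i : ℕ => r ^ i := summable_geometric_of_lt_one hr0.le hr1
  set c' := max c 0 with hc'
  refine ⟨c' * (1 - r)⁻¹ + 1, ?_, fun x hx => ?_⟩
  · have : 0 < (1 - r)⁻¹ := inv_pos.2 (by linarith)
    positivity
  have hb : ∀ i : ℕ, m ^ i * F (m ^ (i + 1) * x) ≤ c' * F x * r ^ i := by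
    intro i
    have hmi : 1 ≤ m ^ i := one_le_pow₀ hm1.le
    have hmi1 : 1 < m ^ (i + 1) := one_lt_pow₀ hm1 (by omega)
    have q := hc x hx (m ^ (i + 1)) hmi1
    rw [mul_comm x] at q
    have hFx := h.pos x
    have hri : r ^ i = (m ^ i) ^ (-δ) := by
      rw [hr, ← Real.rpow_natCast, ← Real.rpow_natCast, ← Real.rpow_mul hm0.le,
        ← Real.rpow_mul hm0.le, mul_comm]
    have q2 : m ^ i * (1 / (m ^ (i + 1)) ^ (1 + δ)) ≤ r ^ i := by
      have q3 : (m ^ i) ^ (1 + δ) ≤ (m ^ (i + 1)) ^ (1 + δ) :=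
        Real.rpow_le_rpow (by positivity) (pow_le_pow_right₀ hm1.le (by omega)) (by linarith)
      calc m ^ i * (1 / (m ^ (i + 1)) ^ (1 + δ)) ≤ m ^ i * (1 / (m ^ i) ^ (1 + δ)) := by gcongr
        _ = r ^ i := by
          rw [hri, Real.rpow_neg (by positivity), Real.rpow_add (by positivity), Real.rpow_one]
          field_simp
    calc m ^ i * F (m ^ (i + 1) * x) ≤ m ^ i * (c' * F x / (m ^ (i + 1)) ^ (1 + δ)) := by
          refine mul_le_mul_of_nonneg_left (q.trans ?_) (by positivity)
          refine div_le_div_of_nonneg_right ?_ (by positivity)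
          exact mul_le_mul_of_nonneg_right (le_max_left _ _) hFx.le
      _ = c' * F x * (m ^ i * (1 / (m ^ (i + 1)) ^ (1 + δ))) := by ring
      _ ≤ _ := by gcongr
  have hs : Summable (fun i : ℕ => m ^ i * F (m ^ (i + 1) * x)) :=
    Summable.of_nonneg_of_le (fun i => mul_nonneg (by positivity) (h.pos _).le) hb
      (hg.mul_left _)
  refine ⟨hs, ?_⟩
  have := hs.tsum_le_tsum hb (hg.mul_left _)
  rw [tsum_mul_left, tsum_geometric_of_lt_one hr0.le hr1] at this
  have hFx := h.pos x
  linarith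

end GwF

lemma gw_final {F G : ℝ → ℝ} {δ m A : ℝ} (h : GwF F δ) (hm1 : 1 < m) (hA : 0 ≤ A)
    (hIRV : Tendsto
      (fun ε : ℝ => Filter.liminf (fun x : ℝ => F (x * (1 + ε)) / F x) atTop)
      (nhdsWithin 0 (Set.Ioi 0)) (nhds 1))
    (hG0 : ∀ x, 0 ≤ G x) (hGA : ∀ x, 0 < x → G x ≤ A * F x)
    (hRp : ∀ e η : ℝ, 0 < e → e < 1 → 0 < η → ∀ᶠ x in atTop,
      G x ≤ F ((1 - e) * (m * x)) + m * G ((1 - e) * (m * x)) + η * F x)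
    (hRm : ∀ e η : ℝ, 0 < e → e < 1 → 0 < η → η < 1 → ∀ᶠ x in atTop,
      (1 - η) * (F ((1 + e) * (m * x)) + m * G ((1 + e) * (m * x))) ≤ G x) :
    Tendsto (fun x : ℝ => G x / (∑' i : ℕ, m ^ i * F (m ^ (i + 1) * x))) atTop (nhds 1) := by
  have hm0 : 0 < m := by linarith
  obtain ⟨K, hK, hsm⟩ := h.summ hm1
  set S : ℝ → ℝ := fun x => ∑' i : ℕ, m ^ i * F (m ^ (i + 1) * x) with hS
  have hnn : ∀ x (i : ℕ), 0 ≤ m ^ i * F (m ^ (i + 1) * x) := fun x i =>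
    mul_nonneg (by positivity) (h.pos _).le
  have hSrec : ∀ x, 1 < x → S x = F (m * x) + m * S (m * x) := by
    intro x hx
    have h1 := (hsm x hx).1.tsum_eq_zero_add
    have h2 : ∀ i : ℕ, m ^ (i + 1) * F (m ^ (i + 1 + 1) * x) =
        m * (m ^ i * F (m ^ (i + 1) * (m * x))) := by
      intro i
      rw [show m ^ (i + 1 + 1) * x = m ^ (i + 1) * (m * x) by ring]; ring
    simp only [h2] at h1
    rw [tsum_mul_left] at h1
    simpa [hS] using h1
  have hSF : ∀ x, 1 < x → F (m * x) ≤ S x := by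
    intro x hx
    rw [hSrec x hx]
    have : 0 ≤ S (m * x) := tsum_nonneg (hnn _)
    have : 0 ≤ m * S (m * x) := by positivity
    linarith
  have hSpos : ∀ x, 1 < x → 0 < S x := fun x hx => lt_of_lt_of_le (h.pos _) (hSF x hx)
  obtain ⟨C, hC1, hCs⟩ := h.scale (κ := 1 / m) (by positivity)
  have hFC : ∀ x, 1 < x → F x ≤ C * F (m * x) := by
    intro x hx
    have := hCs (m * x) (by positivity)
    rwa [show 1 / m * (m * x) = x by field_simp] at this
  set θ := 1 / (K * C + 1) with hθ
  have hθ0 : 0 < θ := by positivity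
  have hθ1 : θ < 1 := by
    rw [hθ, div_lt_one (by positivity)]
    have : 0 < K * C := by positivity
    linarith
  have hθS : ∀ x, 1 < x → θ * S x ≤ F (m * x) := by
    intro x hx
    have h1 := (hsm x hx).2
    have h2 : K * F x ≤ K * (C * F (m * x)) := mul_le_mul_of_nonneg_left (hFC x hx) hK.le
    rw [hθ, one_div_mul_eq_div, div_le_iff₀ (by positivity)]
    have := h.pos (m * x)
    calc S x ≤ K * F x := h1
      _ ≤ F (m * x) * (K * C + 1) := by nlinarith
  have hSirv : ∀ η : ℝ, 0 < η → ∃ e : ℝ, 0 < e ∧ e < 1 ∧ ∀ᶠ x in atTop,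
      (1 - η) * F x ≤ F ((1 + e) * x) ∧ (1 - η) * F ((1 - e) * x) ≤ F x ∧
      (1 - η) * S x ≤ S ((1 + e) * x) ∧ (1 - η) * S ((1 - e) * x) ≤ S x := by
    intro η hη
    obtain ⟨e, he, he1, x0, hx0, hx⟩ := h.irv hIRV hη
    refine ⟨e, he, he1, ?_⟩
    have t0 : Tendsto (fun x : ℝ => (1 - e) * x) atTop atTop :=
      tendsto_id.const_mul_atTop (by linarith)
    filter_upwards [t0.eventually_gt_atTop 1, eventually_ge_atTop x0, eventually_gt_atTop 1]
      with x h1 h2 h3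
    have h4 : 1 < (1 + e) * x := by nlinarith
    have hmx : ∀ i : ℕ, x0 ≤ m ^ (i + 1) * x := by
      intro i
      have : 1 ≤ m ^ (i + 1) := one_le_pow₀ hm1.le
      nlinarith
    refine ⟨(hx x h2).1, (hx x h2).2, ?_, ?_⟩
    · simp only [hS]
      rw [← tsum_mul_left]
      refine ((hsm x h3).1.mul_left _).tsum_le_tsum (fun i => ?_) (hsm _ h4).1
      have := mul_le_mul_of_nonneg_left (hx _ (hmx i)).1 (by positivity : 0 ≤ m ^ i)
      rw [show m ^ (i + 1) * ((1 + e) * x) = (1 + e) * (m ^ (i + 1) * x) by ring]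
      linarith
    · simp only [hS]
      rw [← tsum_mul_left]
      refine ((hsm _ h1).1.mul_left _).tsum_le_tsum (fun i => ?_) (hsm x h3).1
      have := mul_le_mul_of_nonneg_left (hx _ (hmx i)).2 (by positivity : 0 ≤ m ^ i)
      rw [show m ^ (i + 1) * ((1 - e) * x) = (1 - e) * (m ^ (i + 1) * x) by ring]
      linarith
  have tm : Tendsto (fun x : ℝ => m * x) atTop atTop := tendsto_id.const_mul_atTop hm0
  -- upper bound
  have stepU : ∀ r : ℝ, 0 < r → (∀ᶠ x in atTop, G x ≤ (1 + r) * S x) →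
      ∀ᶠ x in atTop, G x ≤ (1 + (1 - θ / 2) * r) * S x := by
    intro r hr hU
    have hex : ∃ η : ℝ, 0 < η ∧ η < 1 ∧
        (1 + (1 - θ) * r) / (1 - η) + η * C ≤ 1 + (1 - θ / 2) * r := by
      have hcont : Tendsto (fun η : ℝ => (1 + (1 - θ) * r) / (1 - η) + η * C)
          (nhdsWithin 0 (Set.Ioi 0)) (nhds ((1 + (1 - θ) * r) / (1 - 0) + 0 * C)) := by
        refine Tendsto.mono_left ?_ nhdsWithin_le_nhds
        refine ContinuousAt.tendsto (f := fun η : ℝ => (1 + (1 - θ) * r) / (1 - η) + η * C) ?_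
        refine ContinuousAt.add (ContinuousAt.div (by fun_prop) (by fun_prop) (by norm_num))
          (by fun_prop)
      have hlt : (1 + (1 - θ) * r) / (1 - 0) + 0 * C < 1 + (1 - θ / 2) * r := by
        rw [sub_zero, div_one]; nlinarith
      have e2 : ∀ᶠ η : ℝ in nhdsWithin 0 (Set.Ioi 0), 0 < η := eventually_mem_nhdsWithin
      have e3 : ∀ᶠ η : ℝ in nhdsWithin 0 (Set.Ioi 0), η < 1 :=
        nhdsWithin_le_nhds (Iio_mem_nhds (by norm_num))
      obtain ⟨η, a1, a2, a3⟩ := ((hcont.eventually_lt_const hlt).and (e2.and e3)).exists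
      exact ⟨η, a2, a3, a1.le⟩
    obtain ⟨η, hη, hη1, hηr⟩ := hex
    obtain ⟨e, he, he1, hirv⟩ := hSirv η hη
    have t1 : Tendsto (fun x : ℝ => (1 - e) * (m * x)) atTop atTop :=
      tm.const_mul_atTop (by linarith)
    filter_upwards [tm.eventually hirv, hRp e η he he1 hη, t1.eventually hU, eventually_gt_atTop 1]
      with x h1 h2 h3 h4
    obtain ⟨-, b1, -, b2⟩ := h1
    have hS0 := hSpos x h4
    have f1 : F ((1 - e) * (m * x)) ≤ F (m * x) / (1 - η) := by
      rw [le_div_iff₀ (by linarith)]; linarith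
    have f2 : S ((1 - e) * (m * x)) ≤ S (m * x) / (1 - η) := by
      rw [le_div_iff₀ (by linarith)]; linarith
    have f3 : m * G ((1 - e) * (m * x)) ≤ m * ((1 + r) * (S (m * x) / (1 - η))) := by
      refine mul_le_mul_of_nonneg_left (h3.trans ?_) hm0.le
      exact mul_le_mul_of_nonneg_left f2 (by linarith)
    have f4 : η * F x ≤ η * (C * S x) := by
      refine mul_le_mul_of_nonneg_left ((hFC x h4).trans ?_) hη.le
      exact mul_le_mul_of_nonneg_left (hSF x h4) (by linarith)
    have f5 := hSrec x h4
    have f6 : F (m * x) + m * ((1 + r) * S (m * x)) ≤ (1 + (1 - θ) * r) * S x := by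
      have := mul_le_mul_of_nonneg_left (hθS x h4) hr.le
      have f7 : m * S (m * x) = S x - F (m * x) := by linarith
      calc F (m * x) + m * ((1 + r) * S (m * x)) = F (m * x) + (1 + r) * (m * S (m * x)) := by ring
        _ = (1 + r) * S x - r * F (m * x) := by rw [f7]; ring
        _ ≤ _ := by nlinarith
    have f8 : (F (m * x) + m * ((1 + r) * S (m * x))) / (1 - η) ≤
        (1 + (1 - θ) * r) * S x / (1 - η) := div_le_div_of_nonneg_right f6 (by linarith)
    have f9 := mul_le_mul_of_nonneg_right hηr hS0.le
    calc G x ≤ F (m * x) / (1 - η) + m * ((1 + r) * (S (m * x) / (1 - η))) + η * (C * S x) := by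
          linarith
      _ = (F (m * x) + m * ((1 + r) * S (m * x))) / (1 - η) + η * C * S x := by ring
      _ ≤ (1 + (1 - θ) * r) * S x / (1 - η) + η * C * S x := by linarith
      _ = ((1 + (1 - θ) * r) / (1 - η) + η * C) * S x := by ring
      _ ≤ _ := f9
  have hs0 : 0 < 1 - θ / 2 := by linarith
  have hs1 : 1 - θ / 2 < 1 := by linarith
  set r0 := A * C + 1 with hr0
  have hr00 : 0 < r0 := by positivity
  have itU : ∀ n : ℕ, ∀ᶠ x in atTop, G x ≤ (1 + (1 - θ / 2) ^ n * r0) * S x := by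
    intro n
    induction n with
    | zero =>
      filter_upwards [eventually_gt_atTop 1] with x hx
      have hS0 := hSpos x hx
      have a1 := hGA x (by linarith)
      have a2 : A * F x ≤ A * (C * S x) := by
        refine mul_le_mul_of_nonneg_left ((hFC x hx).trans ?_) hA
        exact mul_le_mul_of_nonneg_left (hSF x hx) (by linarith)
      rw [pow_zero, one_mul, hr0]
      nlinarith
    | succ n ih =>
      have := stepU _ (by positivity) ih
      rwa [← mul_assoc, ← pow_succ'] at this
  -- lower bound
  have stepL : ∀ r : ℝ, 0 < r → r ≤ 1 → (∀ᶠ x in atTop, (1 - r) * S x ≤ G x) →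
      ∀ᶠ x in atTop, (1 - (1 - θ / 2) * r) * S x ≤ G x := by
    intro r hr hr1 hL
    have hex : ∃ η : ℝ, 0 < η ∧ η < 1 ∧
        1 - (1 - θ / 2) * r ≤ (1 - η) ^ 2 * (1 - (1 - θ) * r) := by
      have hcont : Tendsto (fun η : ℝ => (1 - η) ^ 2 * (1 - (1 - θ) * r))
          (nhdsWithin 0 (Set.Ioi 0)) (nhds ((1 - 0) ^ 2 * (1 - (1 - θ) * r))) := by
        refine Tendsto.mono_left ?_ nhdsWithin_le_nhds
        refine ContinuousAt.tendsto (f := fun η : ℝ => (1 - η) ^ 2 * (1 - (1 - θ) * r)) ?_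
        fun_prop
      have hlt : 1 - (1 - θ / 2) * r < (1 - 0) ^ 2 * (1 - (1 - θ) * r) := by
        rw [sub_zero, one_pow, one_mul]; nlinarith
      have e2 : ∀ᶠ η : ℝ in nhdsWithin 0 (Set.Ioi 0), 0 < η := eventually_mem_nhdsWithin
      have e3 : ∀ᶠ η : ℝ in nhdsWithin 0 (Set.Ioi 0), η < 1 :=
        nhdsWithin_le_nhds (Iio_mem_nhds (by norm_num))
      obtain ⟨η, a1, a2, a3⟩ := ((hcont.eventually_const_lt hlt).and (e2.and e3)).exists
      exact ⟨η, a2, a3, a1.le⟩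
    obtain ⟨η, hη, hη1, hηr⟩ := hex
    obtain ⟨e, he, he1, hirv⟩ := hSirv η hη
    have t1 : Tendsto (fun x : ℝ => (1 + e) * (m * x)) atTop atTop :=
      tm.const_mul_atTop (by linarith)
    filter_upwards [tm.eventually hirv, hRm e η he he1 hη hη1, t1.eventually hL,
      eventually_gt_atTop 1] with x h1 h2 h3 h4
    obtain ⟨b1, -, b2, -⟩ := h1
    have hS0 := hSpos x h4
    have f3 : m * ((1 - r) * ((1 - η) * S (m * x))) ≤ m * G ((1 + e) * (m * x)) := by
      refine mul_le_mul_of_nonneg_left (le_trans ?_ h3) hm0.le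
      exact mul_le_mul_of_nonneg_left b2 (by linarith)
    have f4 := mul_le_mul_of_nonneg_left (add_le_add b1 f3) (by linarith : 0 ≤ 1 - η)
    have f5 := hSrec x h4
    have f6 : (1 - (1 - θ) * r) * S x ≤ F (m * x) + m * ((1 - r) * S (m * x)) := by
      have := mul_le_mul_of_nonneg_left (hθS x h4) hr.le
      have f7 : m * S (m * x) = S x - F (m * x) := by linarith
      calc (1 - (1 - θ) * r) * S x ≤ (1 - r) * S x + r * F (m * x) := by nlinarith
        _ = F (m * x) + (1 - r) * (S x - F (m * x)) := by ring
        _ = _ := by rw [← f7]; ring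
    have f9 := mul_le_mul_of_nonneg_right hηr hS0.le
    have f10 := mul_le_mul_of_nonneg_left f6 (sq_nonneg (1 - η))
    calc (1 - (1 - θ / 2) * r) * S x ≤ (1 - η) ^ 2 * ((1 - (1 - θ) * r) * S x) := by linarith
      _ ≤ (1 - η) ^ 2 * (F (m * x) + m * ((1 - r) * S (m * x))) := f10
      _ = (1 - η) * ((1 - η) * F (m * x) + m * ((1 - r) * ((1 - η) * S (m * x)))) := by ring
      _ ≤ _ := f4.trans h2
  have itL : ∀ n : ℕ, ∀ᶠ x in atTop, (1 - (1 - θ / 2) ^ n) * S x ≤ G x := by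
    intro n
    induction n with
    | zero => exact Eventually.of_forall fun x => by simpa using hG0 x
    | succ n ih =>
      have := stepL _ (by positivity) (pow_le_one₀ hs0.le hs1.le) ih
      rwa [← pow_succ'] at this
  have hp0 : Tendsto (fun n : ℕ => (1 - θ / 2) ^ n) atTop (nhds 0) :=
    tendsto_pow_atTop_nhds_zero_of_lt_one hs0.le hs1
  rw [tendsto_order]
  constructor
  · intro a ha
    obtain ⟨n, hn⟩ := (hp0.eventually_lt_const (by linarith : 0 < 1 - a)).exists
    filter_upwards [itL n, eventually_gt_atTop 1] with x hx1 hx2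
    rw [lt_div_iff₀ (hSpos x hx2)]
    exact lt_of_lt_of_le (mul_lt_mul_of_pos_right (by linarith) (hSpos x hx2)) hx1
  · intro a ha
    have hp1 := hp0.mul_const r0
    rw [zero_mul] at hp1
    obtain ⟨n, hn⟩ := (hp1.eventually_lt_const (by linarith : 0 < a - 1)).exists
    filter_upwards [itU n, eventually_gt_atTop 1] with x hx1 hx2
    rw [div_lt_iff₀ (hSpos x hx2)]
    exact lt_of_le_of_lt hx1 (mul_lt_mul_of_pos_right (by linarith) (hSpos x hx2))


/-- If the offspring distribution `F` is dominated varying,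
satisfies condition (C) and is intermediate regularly varying, then
`ℙ(W > x) ~ ∑_{i=0}^{∞} m^i F̄(m^{i+1} x)` as `x → ∞`, where `W` is the
almost sure limit of `W_n`. -/
theorem gw_irv_limit_asymptotics
    {Ω : Type*} [MeasurableSpace Ω] (μ : Measure Ω) [IsProbabilityMeasure μ]
    (ξ : ℕ → ℕ → Ω → ℕ)
    (hmeas : ∀ n i, Measurable (ξ n i))
    (hindep : iIndepFun
      (fun p : ℕ × ℕ => ξ p.1 p.2) μ)
    (hident : ∀ n i, Measure.map (ξ n i) μ = Measure.map (ξ 0 0) μ)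
    (hint : Integrable (fun ω => (ξ 0 0 ω : ℝ)) μ)
    (m : ℝ) (hm : m = ∫ ω, (ξ 0 0 ω : ℝ) ∂μ) (hm1 : 1 < m)
    (Z : ℕ → Ω → ℕ)
    (hZ0 : ∀ ω, Z 0 ω = 1)
    (hZrec : ∀ n ω, Z (n + 1) ω = ∑ i ∈ Finset.range (Z n ω), ξ n i ω)
    (W : ℕ → Ω → ℝ) (hW : ∀ n ω, W n ω = (Z n ω : ℝ) / m ^ n)
    (Fbar : ℝ → ℝ) (hFbar : ∀ x, Fbar x = (μ {ω | x < (ξ 0 0 ω : ℝ)}).toReal)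
    (Wlim : Ω → ℝ)
    (hWlim : ∀ᵐ ω ∂μ, Tendsto (fun n => W n ω) atTop (nhds (Wlim ω)))
    -- `F` is dominated varying
    (hDV : ∃ C : ℝ, ∀ x : ℝ, Fbar (x / 2) ≤ C * Fbar x)
    -- condition (C)
    (hC : ∃ δ > (0 : ℝ), ∃ c : ℝ, ∀ x > (1 : ℝ), ∀ y > (1 : ℝ),
      Fbar (x * y) ≤ c * Fbar x / y ^ (1 + δ))
    -- `F` is intermediate regularly varying
    (hIRV : Tendsto
      (fun ε : ℝ => Filter.liminf (fun x : ℝ => Fbar (x * (1 + ε)) / Fbar x) atTop)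
      (nhdsWithin 0 (Set.Ioi 0)) (nhds 1)) :
    Tendsto (fun x : ℝ => (μ {ω | x < Wlim ω}).toReal /
        (∑' i : ℕ, m ^ i * Fbar (m ^ (i + 1) * x))) atTop (nhds 1) := by
  obtain ⟨δ, hδ, hCc⟩ := hC
  have hFm : ∀ x, Fbar x = μ.real {ω | x < (ξ 0 0 ω : ℝ)} := hFbar
  have hanti : Antitone Fbar := by
    intro a b hab
    rw [hFm, hFm]
    exact measureReal_mono fun ω hω => lt_of_le_of_lt hab hω
  have hnn : ∀ x, 0 ≤ Fbar x := fun x => by rw [hFm]; exact measureReal_nonneg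
  have hpos : ∀ x, 0 < Fbar x := by
    intro x1
    by_contra hcon
    have hz : ∀ x, x1 ≤ x → Fbar x = 0 := fun x hx =>
      le_antisymm ((hanti hx).trans (not_lt.1 hcon)) (hnn x)
    have hl : ∀ ε : ℝ, Filter.liminf (fun x : ℝ => Fbar (x * (1 + ε)) / Fbar x) atTop = 0 := by
      intro ε
      have : (fun x : ℝ => Fbar (x * (1 + ε)) / Fbar x) =ᶠ[atTop] fun _ => (0 : ℝ) := by
        filter_upwards [eventually_ge_atTop x1] with x hx
        rw [hz x hx, div_zero]
      rw [liminf_congr this, liminf_const]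
    simp only [hl] at hIRV
    have := tendsto_nhds_unique hIRV tendsto_const_nhds
    norm_num at this
  have hF : GwF Fbar δ := ⟨hanti, hpos, hDV, hδ, hCc⟩
  have hF' : GwF (fun x => μ.real {ω | x < (ξ 0 0 ω : ℝ)}) δ := by
    have : Fbar = fun x => μ.real {ω | x < (ξ 0 0 ω : ℝ)} := funext hFm
    rwa [this] at hF
  have hp1 : 1 < min (1 + δ / 2) 2 := lt_min (by linarith) (by norm_num)
  have hpδ : min (1 + δ / 2) 2 < 1 + δ := lt_of_le_of_lt (min_le_left _ _) (by linarith)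
  have hip := gw_moment (f := fun ω => (ξ 0 0 ω : ℝ)) (measurable_from_top.comp (hmeas 0 0))
    (fun ω => by positivity) hF' hp1 hpδ
  have h : GwS μ ξ Z m (min (1 + δ / 2) 2) :=
    ⟨inferInstance, hmeas, hindep, hident, hint, hm.symm, hm1, hZ0, hZrec, hp1, min_le_right _ _,
      hip⟩
  have hlim : ∀ᵐ ω ∂μ, Tendsto (fun n => (Z n ω : ℝ) / m ^ n) atTop (nhds (Wlim ω)) := by
    simpa only [hW] using hWlim
  obtain ⟨A, hA0, hA⟩ := h.crudeW hF hFm hlim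
  exact gw_final (G := fun x => μ.real {ω | x < Wlim ω}) hF hm1 hA0 hIRV
    (fun x => measureReal_nonneg) hA (fun e η => h.Rplus hF hFm hlim e η)
    (fun e η => h.Rminus hF hFm hlim e η)
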